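/- arXiv:1605.05441 — 5 statements merged into one kernel-verified Lean document; each statement's English description precedes it below -/
import Mathlib

section
/- Let d ∈ ℕ, let G ∈ ℝ^{d×d} have spectral radius strictly less than 1, and let Σ ∈ ℝ^{d×d} be symmetric positive definite. Then the series Σ_{l=0}^∞ G^l Σ (G^T)^l converges, its sum is symmetric positive definite, and, writing 𝒜 for the inverse of this sum and setting M = 𝒜(I−G)^{-1} and N = 𝒜(I−G)^{-1}G, one has: 𝒜 = M − N, 𝒜 is symmetric positive definite, M is invertible with M^{-1}N = G, and M^{-1}(M^T + N)M^{-T} = Σ. -/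
open Matrix

open Filter Topology

/-- In a complex Banach algebra, the powers of an element whose spectrum lies in the open unit
disc are eventually bounded by a convergent geometric sequence. -/
theorem exists_eventually_norm_pow_le {A : Type*} [NormedRing A] [NormedAlgebra ℂ A]
    [CompleteSpace A] (a : A) (ha : ∀ z ∈ spectrum ℂ a, ‖z‖ < 1) :
    ∃ r : ℝ, 0 ≤ r ∧ r < 1 ∧ ∀ᶠ n : ℕ in atTop, ‖a ^ n‖ ≤ r ^ n := by
  have hrad : spectralRadius ℂ a < 1 := by
    rcases (spectrum ℂ a).eq_empty_or_nonempty with h | h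
    · simp [spectralRadius, h]
    · exact_mod_cast spectrum.spectralRadius_lt_of_forall_lt_of_nonempty h
        (r := 1) fun z hz => by exact_mod_cast ha z hz
  obtain ⟨r, hr, hr1⟩ := ENNReal.lt_iff_exists_nnreal_btwn.1 hrad
  refine ⟨r, r.2, by exact_mod_cast hr1, ?_⟩
  have h := (spectrum.pow_nnnorm_pow_one_div_tendsto_nhds_spectralRadius a).eventually_lt_const hr
  filter_upwards [h, eventually_gt_atTop 0] with n hn hn0
  have hn' : (n : ℝ) ≠ 0 := by positivity
  have h1 := ENNReal.rpow_le_rpow hn.le (Nat.cast_nonneg (α := ℝ) n)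
  rw [← ENNReal.rpow_mul, one_div_mul_cancel hn', ENNReal.rpow_one, ENNReal.rpow_natCast] at h1
  exact_mod_cast h1

namespace Matrix

variable {n : Type*} [Fintype n] [DecidableEq n]

section Norm

attribute [local instance] Matrix.linftyOpNormedRing Matrix.linftyOpNormedAlgebra

/-- The entries of the powers of a real matrix with spectral radius less than one are eventually
bounded by a convergent geometric sequence. -/
theorem exists_eventually_abs_pow_apply_le (G : Matrix n n ℝ)
    (hG : ∀ z ∈ spectrum ℂ (G.map (algebraMap ℝ ℂ)), ‖z‖ < 1) :
    ∃ r : ℝ, 0 ≤ r ∧ r < 1 ∧ ∀ᶠ l : ℕ in atTop, ∀ i j, |(G ^ l) i j| ≤ r ^ l := by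
  have : CompleteSpace (Matrix n n ℂ) := FiniteDimensional.complete ℂ _
  obtain ⟨r, hr0, hr1, hr⟩ := exists_eventually_norm_pow_le (G.map (algebraMap ℝ ℂ)) hG
  refine ⟨r, hr0, hr1, hr.mono fun l hl i j => le_trans ?_ hl⟩
  have hmap : G.map (algebraMap ℝ ℂ) ^ l = (G ^ l).map (algebraMap ℝ ℂ) :=
    (map_pow (algebraMap ℝ ℂ).mapMatrix G l).symm
  rw [hmap, linfty_opNorm_def]
  calc |(G ^ l) i j| = ((‖(G ^ l).map (algebraMap ℝ ℂ) i j‖₊ : NNReal) : ℝ) := by simp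
    _ ≤ _ := by
      refine NNReal.coe_le_coe.2 (le_trans ?_ (Finset.le_sup (Finset.mem_univ i)))
      exact Finset.single_le_sum
        (f := fun k => ‖(G ^ l).map (algebraMap ℝ ℂ) i k‖₊)
        (fun _ _ => zero_le) (Finset.mem_univ j)

end Norm

theorem summable_pow_mul_mul_transpose_pow (G S : Matrix n n ℝ)
    (hG : ∀ z ∈ spectrum ℂ (G.map (algebraMap ℝ ℂ)), ‖z‖ < 1) :
    Summable fun l : ℕ => G ^ l * S * Gᵀ ^ l := by
  obtain ⟨r, hr0, hr1, hr⟩ := exists_eventually_abs_pow_apply_le G hG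
  refine Pi.summable.2 fun i => Pi.summable.2 fun j => ?_
  simp only [← transpose_pow, mul_apply, transpose_apply, Finset.sum_mul]
  refine summable_sum fun k _ => summable_sum fun m _ => ?_
  refine Summable.of_norm_bounded_eventually_nat
    (g := fun l => |S m k| * (r ^ 2) ^ l)
    ((summable_geometric_of_lt_one (by positivity) (by nlinarith)).mul_left _) ?_
  filter_upwards [hr] with l hl
  rw [Real.norm_eq_abs, abs_mul, abs_mul]
  calc |(G ^ l) i m| * |S m k| * |(G ^ l) j k| ≤ r ^ l * |S m k| * r ^ l := by
        gcongr
        exacts [hl i m, hl j k]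
    _ = |S m k| * (r ^ 2) ^ l := by ring

theorem isUnit_one_sub_of_spectrum_norm_lt_one (G : Matrix n n ℝ)
    (hG : ∀ z ∈ spectrum ℂ (G.map (algebraMap ℝ ℂ)), ‖z‖ < 1) : IsUnit (1 - G) := by
  have h1 : (1 : ℂ) ∉ spectrum ℂ (G.map (algebraMap ℝ ℂ)) := fun h => by simpa using hG 1 h
  rw [spectrum.notMem_iff, map_one, isUnit_iff_isUnit_det, isUnit_iff_ne_zero] at h1
  rw [isUnit_iff_isUnit_det, isUnit_iff_ne_zero]
  intro h
  apply h1
  have := (algebraMap ℝ ℂ).map_det (1 - G)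
  rw [h, map_zero, map_sub, map_one] at this
  exact this.symm

/-- The sum of the series `∑ Gˡ S (Gᵀ)ˡ` solves the discrete Lyapunov equation. -/
theorem eq_add_mul_mul_transpose_of_hasSum {G S X : Matrix n n ℝ}
    (h : HasSum (fun l : ℕ => G ^ l * S * Gᵀ ^ l) X) : X = S + G * X * Gᵀ := by
  have h1 := (h.mul_left G).mul_right Gᵀ
  have h2 := (hasSum_nat_add_iff' 1).2 h
  have h3 : (fun l : ℕ => G ^ (l + 1) * S * Gᵀ ^ (l + 1)) =
      fun l : ℕ => G * (G ^ l * S * Gᵀ ^ l) * Gᵀ := by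
    funext l
    rw [pow_succ' G, pow_succ Gᵀ]
    simp only [Matrix.mul_assoc]
  rw [h3] at h2
  have h4 := h2.unique h1
  simp only [Finset.range_one, Finset.sum_singleton, pow_zero, Matrix.one_mul,
    Matrix.mul_one] at h4
  rw [← h4, add_sub_cancel]

theorem PosDef.of_hasSum_pow_mul_mul_transpose_pow {G S X : Matrix n n ℝ} (hS : S.PosDef)
    (h : HasSum (fun l : ℕ => G ^ l * S * Gᵀ ^ l) X) : X.PosDef := by
  have hpsd (l : ℕ) : (G ^ l * S * Gᵀ ^ l).PosSemidef := by
    simpa [conjTranspose_eq_transpose_of_trivial] using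
      hS.posSemidef.mul_mul_conjTranspose_same (G ^ l)
  refine PosDef.of_dotProduct_mulVec_pos ?_ fun x hx => ?_
  · refine h.matrix_conjTranspose.unique ?_
    simpa only [(hpsd _).isHermitian.eq] using h
  · have hsum : HasSum (fun l : ℕ => star x ⬝ᵥ (G ^ l * S * Gᵀ ^ l) *ᵥ x)
        (star x ⬝ᵥ X *ᵥ x) := by
      refine h.map (⟨⟨fun Y => star x ⬝ᵥ Y *ᵥ x, by simp⟩, fun Y Z => by
        simp [add_mulVec]⟩ : Matrix n n ℝ →+ ℝ) ?_
      change Continuous fun Y : Matrix n n ℝ => star x ⬝ᵥ Y *ᵥ x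
      fun_prop
    have h0 := le_hasSum hsum 0 fun l _ => (hpsd l).dotProduct_mulVec_nonneg x
    simp only [pow_zero, Matrix.one_mul, Matrix.mul_one] at h0
    exact (hS.dotProduct_mulVec_pos hx).trans_le h0

end Matrix

/-- A convergent stochastic AR(1) process corresponds to a matrix
splitting: if the spectral radius of `G` is less than `1` and `Σ` (here `S`) is
symmetric positive definite, then `∑ Gˡ S (Gᵀ)ˡ` converges to a symmetric positive
definite matrix whose inverse `𝒜` together with `M = 𝒜(I-G)⁻¹`, `N = 𝒜(I-G)⁻¹G`
forms a splitting `𝒜 = M - N` with `M⁻¹N = G` and `M⁻¹(Mᵀ+N)M⁻ᵀ = S`. -/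
theorem ar1_matrix_splitting {d : ℕ} (G S : Matrix (Fin d) (Fin d) ℝ)
    (hG : ∀ z ∈ spectrum ℂ (G.map (algebraMap ℝ ℂ)), ‖z‖ < 1)
    (hS : S.PosDef) :
    ∃ Sinf : Matrix (Fin d) (Fin d) ℝ,
      HasSum (fun l : ℕ => G ^ l * S * (Gᵀ) ^ l) Sinf ∧
      Sinf.IsSymm ∧ Sinf.PosDef ∧
      (Sinf⁻¹ = Sinf⁻¹ * (1 - G)⁻¹ - Sinf⁻¹ * (1 - G)⁻¹ * G) ∧
      (Sinf⁻¹).IsSymm ∧ (Sinf⁻¹).PosDef ∧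
      IsUnit (Sinf⁻¹ * (1 - G)⁻¹) ∧
      (Sinf⁻¹ * (1 - G)⁻¹)⁻¹ * (Sinf⁻¹ * (1 - G)⁻¹ * G) = G ∧
      (Sinf⁻¹ * (1 - G)⁻¹)⁻¹ * ((Sinf⁻¹ * (1 - G)⁻¹)ᵀ + Sinf⁻¹ * (1 - G)⁻¹ * G) *
          ((Sinf⁻¹ * (1 - G)⁻¹)⁻¹)ᵀ = S := by
  obtain ⟨X, hX⟩ := summable_pow_mul_mul_transpose_pow G S hG
  have hpos := hS.of_hasSum_pow_mul_mul_transpose_pow hX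
  have hlyap := eq_add_mul_mul_transpose_of_hasSum hX
  have hsymm : X.IsSymm := by
    simpa [IsSymm, IsHermitian, conjTranspose_eq_transpose_of_trivial] using hpos.isHermitian
  have hU := isUnit_one_sub_of_spectrum_norm_lt_one G hG
  have hUdet := (isUnit_iff_isUnit_det _).1 hU
  have hXdet := (isUnit_iff_isUnit_det _).1 hpos.isUnit
  have hinv : (X⁻¹ * (1 - G)⁻¹)⁻¹ = (1 - G) * X := by
    rw [Matrix.mul_inv_rev, nonsing_inv_nonsing_inv _ hUdet, nonsing_inv_nonsing_inv _ hXdet]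
  have hM : IsUnit (X⁻¹ * (1 - G)⁻¹) :=
    (isUnit_nonsing_inv_iff.2 hpos.isUnit).mul (isUnit_nonsing_inv_iff.2 hU)
  have hMdet := (isUnit_iff_isUnit_det _).1 hM
  have hMN : (X⁻¹ * (1 - G)⁻¹)⁻¹ * (X⁻¹ * (1 - G)⁻¹ * G) = G :=
    nonsing_inv_mul_cancel_left _ _ hMdet
  refine ⟨X, hX, hsymm, hpos, ?_, ?_, hpos.inv, hM, hMN, ?_⟩
  · rw [← mul_one_sub, nonsing_inv_mul_cancel_right _ _ hUdet]
  · rw [IsSymm, transpose_nonsing_inv, hsymm.eq]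
  · rw [Matrix.mul_add, hMN, Matrix.add_mul, Matrix.mul_assoc, ← transpose_mul,
      nonsing_inv_mul _ hMdet, transpose_one, Matrix.mul_one, hinv, transpose_mul, hsymm.eq,
      transpose_sub, transpose_one]
    calc (1 - G) * X + G * (X * (1 - Gᵀ)) = X - G * X * Gᵀ := by noncomm_ring
      _ = S := sub_eq_of_eq_add hlyap
end

section
/- Let G ∈ ℝ^{d×d} have spectral radius strictly less than 1 and let Σ ∈ ℝ^{d×d} be symmetric positive definite with GΣ symmetric. Then Σ_{l=0}^∞ G^l Σ (G^T)^l = (I − G²)^{-1} Σ, and the matrices M = Σ^{-1}(I + G), N = Σ^{-1}(I + G)G and 𝒜 = Σ^{-1}(I − G²) satisfy: 𝒜 = M − N, M^{-1}N = G, M^{-1}(M^T + N)M^{-T} = Σ, and M, N, 𝒜 are all symmetric (a symmetric matrix splitting). -/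
open Matrix

/-- In a complex Banach algebra, the powers of an element whose spectrum lies in the open unit disc
are absolutely summable. -/
theorem summable_norm_pow_of_spectrum_norm_lt_one {A : Type*} [NormedRing A] [NormedAlgebra ℂ A]
    [CompleteSpace A] {a : A} (ha : ∀ z ∈ spectrum ℂ a, ‖z‖ < 1) :
    Summable fun n : ℕ => ‖a ^ n‖ := by
  cases subsingleton_or_nontrivial A with
  | inl h =>
    have h0 : (fun n : ℕ => ‖a ^ n‖) = fun _ => 0 := by
      funext n
      rw [Subsingleton.elim (a ^ n) 0, norm_zero]
    rw [h0]
    exact summable_zero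
  | inr h =>
    have hρ : spectralRadius ℂ a < (1 : NNReal) :=
      spectrum.spectralRadius_lt_of_forall_lt a fun z hz => by exact_mod_cast ha z hz
    obtain ⟨r, hρr, hr1⟩ := ENNReal.lt_iff_exists_nnreal_btwn.mp hρ
    have hr : r < 1 := by exact_mod_cast hr1
    refine Summable.of_norm_bounded_eventually_nat
      (summable_geometric_of_lt_one r.coe_nonneg hr) ?_
    filter_upwards [(spectrum.pow_nnnorm_pow_one_div_tendsto_nhds_spectralRadius a).eventually_lt_const
      hρr, Filter.eventually_gt_atTop 0] with n hn hn0
    have hn' : (n : ℝ) ≠ 0 := by positivity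
    have h2 := ENNReal.rpow_le_rpow hn.le n.cast_nonneg
    rw [← ENNReal.rpow_mul, one_div_mul_cancel hn', ENNReal.rpow_one, ENNReal.rpow_natCast] at h2
    rw [norm_norm]
    exact_mod_cast h2

namespace Matrix

variable {n : Type*} [Fintype n] [DecidableEq n]

section

attribute [local instance] Matrix.linftyOpNormedRing Matrix.linftyOpNormedAlgebra

theorem summable_pow_of_complex_spectrum_norm_lt_one {G : Matrix n n ℂ}
    (hG : ∀ z ∈ spectrum ℂ G, ‖z‖ < 1) : Summable fun k : ℕ => G ^ k :=
  (summable_norm_pow_of_spectrum_norm_lt_one hG).of_norm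

end

theorem summable_pow_of_spectrum_norm_lt_one {G : Matrix n n ℝ}
    (hG : ∀ z ∈ spectrum ℂ (G.map (algebraMap ℝ ℂ)), ‖z‖ < 1) : Summable fun k : ℕ => G ^ k := by
  have h := (summable_pow_of_complex_spectrum_norm_lt_one hG).map
    (Complex.reCLM.toLinearMap.toAddMonoidHom.mapMatrix (m := n) (n := n))
    (continuous_id.matrix_map Complex.continuous_re)
  refine h.congr fun k => ?_
  have hk : G.map (algebraMap ℝ ℂ) ^ k = (G ^ k).map (algebraMap ℝ ℂ) :=
    (map_pow (algebraMap ℝ ℂ).mapMatrix G k).symm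
  ext i j
  change ((G.map (algebraMap ℝ ℂ) ^ k) i j).re = (G ^ k) i j
  rw [hk]
  exact Complex.ofReal_re _

theorem hasSum_pow_of_summable {A : Matrix n n ℝ} (hA : Summable fun k : ℕ => A ^ k) :
    IsUnit (1 - A).det ∧ HasSum (fun k : ℕ => A ^ k) (1 - A)⁻¹ := by
  have h := hA.one_sub_mul_tsum_pow
  exact ⟨isUnit_det_of_right_inverse h, inv_eq_right_inv h ▸ hA.hasSum⟩

end Matrix

/-- If the spectral radius of `G` is less than `1`, `Σ` (here `S`) is
symmetric positive definite and `G * S` is symmetric, then the AR(1) process has the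
symmetric matrix splitting `M = S⁻¹(I+G)`, `N = S⁻¹(I+G)G`, `𝒜 = S⁻¹(I-G²)`, and
`∑ Gˡ S (Gᵀ)ˡ = (I-G²)⁻¹ S`. -/
theorem ar1_symmetric_matrix_splitting {d : ℕ} (G S : Matrix (Fin d) (Fin d) ℝ)
    (hG : ∀ z ∈ spectrum ℂ (G.map (algebraMap ℝ ℂ)), ‖z‖ < 1)
    (hS : S.PosDef) (hGS : (G * S).IsSymm) :
    HasSum (fun l : ℕ => G ^ l * S * (Gᵀ) ^ l) ((1 - G ^ 2)⁻¹ * S) ∧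
    S⁻¹ * (1 - G ^ 2) = S⁻¹ * (1 + G) - S⁻¹ * (1 + G) * G ∧
    (S⁻¹ * (1 + G))⁻¹ * (S⁻¹ * (1 + G) * G) = G ∧
    (S⁻¹ * (1 + G))⁻¹ * ((S⁻¹ * (1 + G))ᵀ + S⁻¹ * (1 + G) * G) * ((S⁻¹ * (1 + G))⁻¹)ᵀ = S ∧
    (S⁻¹ * (1 + G)).IsSymm ∧ (S⁻¹ * (1 + G) * G).IsSymm ∧ (S⁻¹ * (1 - G ^ 2)).IsSymm := by
  have hpow := (summable_pow_of_spectrum_norm_lt_one hG).comp_injective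
    (mul_right_injective₀ (two_ne_zero' ℕ))
  obtain ⟨hunit, hsum⟩ := hasSum_pow_of_summable (A := G ^ 2) (hpow.congr fun k => by
    simp [pow_mul])
  have hfactor : 1 - G ^ 2 = (1 + G) * (1 - G) := by noncomm_ring
  have hplus : IsUnit (1 + G).det := by
    rw [hfactor, det_mul] at hunit
    exact isUnit_of_mul_isUnit_left hunit
  have hSdet : IsUnit S.det := hS.det_pos.ne'.isUnit
  have hSsymm : Sᵀ = S := hS.isHermitian
  have hSG : S * Gᵀ = G * S := by simpa [IsSymm, hSsymm] using hGS
  have hpowSG (l : ℕ) : S * Gᵀ ^ l = G ^ l * S :=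
    (show SemiconjBy S Gᵀ G from hSG).pow_right l
  have hGtS : Gᵀ * S⁻¹ = S⁻¹ * G := by
    calc Gᵀ * S⁻¹ = S⁻¹ * (S * Gᵀ) * S⁻¹ := by rw [nonsing_inv_mul_cancel_left _ _ hSdet]
      _ = S⁻¹ * G := by rw [hSG, ← mul_assoc, mul_nonsing_inv_cancel_right _ _ hSdet]
  have hSinv : (S⁻¹)ᵀ = S⁻¹ := by rw [transpose_nonsing_inv, hSsymm]
  have hGtSG : Gᵀ * (S⁻¹ * G) = S⁻¹ * (G * G) := by
    rw [← mul_assoc, hGtS, mul_assoc]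
  have hMdet : IsUnit (S⁻¹ * (1 + G)).det := by
    rw [det_mul]
    exact (isUnit_nonsing_inv_det S hSdet).mul hplus
  have hM : (S⁻¹ * (1 + G)).IsSymm := by
    simp only [IsSymm, transpose_mul, transpose_add, hSinv, mul_add, mul_one, hGtS]
  refine ⟨?_, by noncomm_ring, nonsing_inv_mul_cancel_left _ _ hMdet, ?_, hM, ?_, ?_⟩
  · refine (hsum.mul_right S).congr_fun fun l => ?_
    rw [mul_assoc, hpowSG, ← mul_assoc, ← pow_add, ← pow_mul, two_mul]
  · have hMN : S⁻¹ * (1 + G) + S⁻¹ * (1 + G) * G = S⁻¹ * (1 + G) * (1 + G) := by noncomm_ring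
    rw [hM.eq, transpose_nonsing_inv, hM.eq, hMN, nonsing_inv_mul_cancel_left _ _ hMdet,
      Matrix.mul_inv_rev, nonsing_inv_nonsing_inv _ hSdet, mul_nonsing_inv_cancel_left _ _ hplus]
  · simp only [IsSymm, transpose_mul, transpose_add, hSinv, add_mul, mul_add,
      mul_one, hGtS, hGtSG, mul_assoc]
  · simp only [IsSymm, transpose_mul, transpose_sub, hSinv, mul_sub,
      mul_one, pow_two, hGtS, hGtSG, mul_assoc]
end

section
/- Let A, M, N ∈ ℝ^{d×d} with A, M and N all symmetric and M + N invertible, set 𝒜 = M − N, and let b, β ∈ ℝ^d. Then for all x, y ∈ ℝ^d: −y^T A y + x^T A x + 2b^T(y − x) − (Mx − Ny − β)^T (M+N)^{-1} (Mx − Ny − β) + (My − Nx − β)^T (M+N)^{-1} (My − Nx − β) = −y^T(A − 𝒜)y + x^T(A − 𝒜)x + 2(b − β)^T(y − x). Consequently, for the Gaussian target with density π(x) ∝ exp(−½x^T A x + b^T x) and the AR(1) proposal density q(x,y) ∝ exp(−½(My − Nx − β)^T (M^T+N)^{-1} (My − Nx − β)), the Metropolis–Hastings acceptance probability equals α(x,y)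 = 1 ∧ exp(−½ y^T(A − 𝒜)y + ½ x^T(A − 𝒜)x + (b − β)^T(y − x)). -/
open Matrix

theorem Matrix.IsSymm.dotProduct_mulVec_comm {n R : Type*} [Fintype n] [CommSemiring R]
    {S : Matrix n n R} (hS : S.IsSymm) (v w : n → R) : v ⬝ᵥ S *ᵥ w = w ⬝ᵥ S *ᵥ v := by
  rw [dotProduct_mulVec, ← mulVec_transpose, hS.eq, dotProduct_comm]

/-- Difference of the quadratic form of `S⁻¹` at two points that differ by `S *ᵥ w`. -/
theorem Matrix.IsSymm.inv_quadratic_sub {n R : Type*} [Fintype n] [DecidableEq n] [CommRing R]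
    {S : Matrix n n R} (hS : S.IsSymm) (hu : IsUnit S) {u v w : n → R} (h : v - u = S *ᵥ w) :
    v ⬝ᵥ S⁻¹ *ᵥ v - u ⬝ᵥ S⁻¹ *ᵥ u = w ⬝ᵥ (u + v) := by
  have hdet : IsUnit S.det := (isUnit_iff_isUnit_det S).mp hu
  have hSinv : S⁻¹ *ᵥ (S *ᵥ w) = w := by
    rw [mulVec_mulVec, nonsing_inv_mul S hdet, one_mulVec]
  have hinv : S⁻¹.IsSymm := by rw [Matrix.IsSymm, transpose_nonsing_inv, hS.eq]
  obtain rfl : v = u + S *ᵥ w := by rw [← h]; abel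
  have hcross := hinv.dotProduct_mulVec_comm (S *ᵥ w) u
  rw [hSinv] at hcross
  simp only [mulVec_add, dotProduct_add, add_dotProduct, hSinv, hcross, dotProduct_comm w]
  ring

/-- Lemma 1 of the paper. For a symmetric splitting `𝒜 = M - N` of a
symmetric matrix, the Metropolis–Hastings log acceptance ratio for a Gaussian target
`π(x) ∝ exp(-½xᵀAx + bᵀx)` and the AR(1) proposal density
`q(x,y) ∝ exp(-½(My - Nx - β)ᵀ(Mᵀ+N)⁻¹(My - Nx - β))` simplifies, so that
`α(x,y) = 1 ∧ exp(-½yᵀ(A-𝒜)y + ½xᵀ(A-𝒜)x + (b-β)ᵀ(y-x))`. -/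
theorem mh_acceptance_gaussian_target {d : ℕ} (A M N : Matrix (Fin d) (Fin d) ℝ)
    (b β : Fin d → ℝ) (hA : A.IsSymm) (hM : M.IsSymm) (hN : N.IsSymm)
    (hMN : IsUnit (M + N)) :
    (∀ x y : Fin d → ℝ,
      -(y ⬝ᵥ A.mulVec y) + x ⬝ᵥ A.mulVec x + 2 * (b ⬝ᵥ (y - x))
        - ((M.mulVec x - N.mulVec y - β) ⬝ᵥ
            (M + N)⁻¹.mulVec (M.mulVec x - N.mulVec y - β))
        + ((M.mulVec y - N.mulVec x - β) ⬝ᵥ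
            (M + N)⁻¹.mulVec (M.mulVec y - N.mulVec x - β))
      = -(y ⬝ᵥ (A - (M - N)).mulVec y) + x ⬝ᵥ (A - (M - N)).mulVec x
          + 2 * ((b - β) ⬝ᵥ (y - x))) ∧
    (∀ x y : Fin d → ℝ,
      min 1
        ((Real.exp (-(1/2) * (y ⬝ᵥ A.mulVec y) + b ⬝ᵥ y) *
            Real.exp (-(1/2) * ((M.mulVec x - N.mulVec y - β) ⬝ᵥ
              (Mᵀ + N)⁻¹.mulVec (M.mulVec x - N.mulVec y - β)))) /
          (Real.exp (-(1/2) * (x ⬝ᵥ A.mulVec x) + b ⬝ᵥ x) *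
            Real.exp (-(1/2) * ((M.mulVec y - N.mulVec x - β) ⬝ᵥ
              (Mᵀ + N)⁻¹.mulVec (M.mulVec y - N.mulVec x - β)))))
      = min 1 (Real.exp (-(1/2) * (y ⬝ᵥ (A - (M - N)).mulVec y)
            + (1/2) * (x ⬝ᵥ (A - (M - N)).mulVec x) + (b - β) ⬝ᵥ (y - x)))) := by
  have quadratic : ∀ x y : Fin d → ℝ,
      (M *ᵥ y - N *ᵥ x - β) ⬝ᵥ (M + N)⁻¹ *ᵥ (M *ᵥ y - N *ᵥ x - β)
        - (M *ᵥ x - N *ᵥ y - β) ⬝ᵥ (M + N)⁻¹ *ᵥ (M *ᵥ x - N *ᵥ y - β)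
      = y ⬝ᵥ (M - N) *ᵥ y - x ⬝ᵥ (M - N) *ᵥ x - 2 * (β ⬝ᵥ (y - x)) := by
    intro x y
    rw [(hM.add hN).inv_quadratic_sub hMN (w := y - x)
      (by simp only [add_mulVec, mulVec_sub]; abel)]
    simp only [sub_mulVec, dotProduct_add, dotProduct_sub, sub_dotProduct,
      hM.dotProduct_mulVec_comm x y, hN.dotProduct_mulVec_comm x y, dotProduct_comm β]
    ring
  refine ⟨fun x y => ?_, fun x y => ?_⟩
  · have h := quadratic x y
    simp only [sub_mulVec _ _ x, sub_mulVec _ _ y, dotProduct_sub, sub_dotProduct b] at h ⊢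
    linarith
  · have h := quadratic x y
    rw [hM.eq, ← Real.exp_add, ← Real.exp_add, ← Real.exp_sub]
    congr 2
    rw [sub_mulVec A, sub_mulVec A, dotProduct_sub y, dotProduct_sub x, sub_dotProduct b,
      dotProduct_sub b]
    linarith
end

section
/- Under the setup in the context, suppose there exists δ > 0 such that for each j ∈ {1,2,3,4,5}, (Σ_{i=1}^d |T_{ji}|^{2+δ}) / (Σ_{i=1}^d T_{ji}²)^{1+δ/2} → 0 as d → ∞, and that the limits μ = lim_{d→∞} Σ_{i=1}^d μ_{d,i} and σ² = lim_{d→∞} Σ_{i=1}^d σ_{d,i}² exist with σ > 0. Then the log acceptance ratio Z = −½ y^T(A − 𝒜)y + ½ x^T(A − 𝒜)x + (b − β)^T(y − x) converges in distribution to N(μ, σ²) as d → ∞, and the expected acceptance probability satisfies E[1 ∧ e^Z] → Φ(μ/σ) + e^{μ + σ²/2} Φ(−σ − μ/σ) as d → ∞. -/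
open MeasureTheory ProbabilityTheory Matrix Filter
open scoped Topology

noncomputable section MHSetup

/-- The standard Gaussian measure `N(0, I)` on `ℝ^d`. -/
def stdGaussian (d : ℕ) : Measure (Fin d → ℝ) := Measure.pi fun _ => gaussianReal 0 1

/-- Product measure carrying the two independent standard Gaussian inputs
(the one generating the equilibrium state `x` and the proposal noise). -/
def prodGaussian (d : ℕ) : Measure ((Fin d → ℝ) × (Fin d → ℝ)) :=
  (stdGaussian d).prod (stdGaussian d)

/-- Standard normal cumulative distribution function `Φ`. -/
def Phi (x : ℝ) : ℝ := (gaussianReal 0 1 (Set.Iic x)).toReal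

/-- The quantities `T_{ji}` of the paper, as functions of `λ_i`, `λ̃_i`, `G_i`, `r̂_i`. -/
def Tfun (j : ℕ) (lam lamt Gi rhat : ℝ) : ℝ :=
  let r := (lam ^ 2 - lamt ^ 2) / lam ^ 2
  let rt := lam ^ 2 / lamt ^ 2
  let gt := 1 - Gi
  let g := 1 - Gi ^ 2
  match j with
  | 0 => rhat ^ 2 * lam ^ 2 * (r * g / 2 - gt)
  | 1 => rhat * lam * (r * g - gt)
  | 2 => rhat * lam * Real.sqrt (rt * g) * (1 - r * Gi)
  | 3 => r * g / 2
  | 4 => -(r * rt * g) / 2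
  | 5 => -(r * Gi) * Real.sqrt (rt * g)
  | _ => 0

/-- `μ_{d,i} = T_{0i} + T_{3i} + T_{4i}`. -/
def muT (lam lamt Gi rhat : ℝ) : ℝ :=
  Tfun 0 lam lamt Gi rhat + Tfun 3 lam lamt Gi rhat + Tfun 4 lam lamt Gi rhat

/-- `σ_{d,i}² = T_{1i}² + T_{2i}² + 2T_{3i}² + 2T_{4i}² + T_{5i}²`. -/
def sigT2 (lam lamt Gi rhat : ℝ) : ℝ :=
  Tfun 1 lam lamt Gi rhat ^ 2 + Tfun 2 lam lamt Gi rhat ^ 2 +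
    2 * Tfun 3 lam lamt Gi rhat ^ 2 + 2 * Tfun 4 lam lamt Gi rhat ^ 2 +
    Tfun 5 lam lamt Gi rhat ^ 2

/-- The equilibrium state `x ~ N(A⁻¹b, A⁻¹)`, realised as `x = A⁻¹b + Rξ` where
`R Rᵀ = A⁻¹` and `ξ ~ N(0, I)`. -/
def xeq {d : ℕ} (A : Matrix (Fin d) (Fin d) ℝ) (b : Fin d → ℝ)
    (R : Matrix (Fin d) (Fin d) ℝ) (ξ : Fin d → ℝ) : Fin d → ℝ :=
  A⁻¹.mulVec b + R.mulVec ξ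

/-- The AR(1) proposal `y = Gx + M⁻¹β + ν` with `ν = Cν η`, `Cν Cνᵀ = 𝒜⁻¹ - G𝒜⁻¹Gᵀ`,
`η ~ N(0, I)`, driven by the pair `ω = (ξ, η)`. -/
def yprop {d : ℕ} (A M N : Matrix (Fin d) (Fin d) ℝ) (b β : Fin d → ℝ)
    (R Cν : Matrix (Fin d) (Fin d) ℝ) (ω : (Fin d → ℝ) × (Fin d → ℝ)) : Fin d → ℝ :=
  (M⁻¹ * N).mulVec (xeq A b R ω.1) + M⁻¹.mulVec β + Cν.mulVec ω.2

/-- The log Metropolis–Hastings acceptance ratio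
`Z = -½yᵀ(A-𝒜)y + ½xᵀ(A-𝒜)x + (b-β)ᵀ(y-x)` for a Gaussian target. -/
def Zlog {d : ℕ} (A M N : Matrix (Fin d) (Fin d) ℝ) (b β : Fin d → ℝ)
    (R Cν : Matrix (Fin d) (Fin d) ℝ) (ω : (Fin d → ℝ) × (Fin d → ℝ)) : ℝ :=
  -(1/2) * (yprop A M N b β R Cν ω ⬝ᵥ (A - (M - N)).mulVec (yprop A M N b β R Cν ω))
    + (1/2) * (xeq A b R ω.1 ⬝ᵥ (A - (M - N)).mulVec (xeq A b R ω.1))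
    + (b - β) ⬝ᵥ (yprop A M N b β R Cν ω - xeq A b R ω.1)

end MHSetup

theorem Finset.norm_prod_sub_prod_le_sum {ι : Type*} (s : Finset ι) (a b : ι → ℂ)
    (ha : ∀ i, ‖a i‖ ≤ 1) (hb : ∀ i, ‖b i‖ ≤ 1) :
    ‖∏ i ∈ s, a i - ∏ i ∈ s, b i‖ ≤ ∑ i ∈ s, ‖a i - b i‖ := by
  classical
  induction s using Finset.induction_on with
  | empty => simp
  | insert i s hi ih =>
    rw [Finset.prod_insert hi, Finset.prod_insert hi, Finset.sum_insert hi]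
    have hprod : ‖∏ j ∈ s, a j‖ ≤ 1 := by
      rw [norm_prod]
      exact Finset.prod_le_one (fun _ _ => norm_nonneg _) fun j _ => ha j
    calc ‖a i * ∏ j ∈ s, a j - b i * ∏ j ∈ s, b j‖
        = ‖(a i - b i) * ∏ j ∈ s, a j + b i * (∏ j ∈ s, a j - ∏ j ∈ s, b j)‖ := by
          congr 1; ring
      _ ≤ ‖a i - b i‖ * ‖∏ j ∈ s, a j‖ + ‖b i‖ * ‖∏ j ∈ s, a j - ∏ j ∈ s, b j‖ := by
          refine (norm_add_le _ _).trans ?_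
          rw [norm_mul, norm_mul]
      _ ≤ ‖a i - b i‖ * 1 + 1 * ∑ j ∈ s, ‖a j - b j‖ := by
          gcongr
          exact hb i
      _ = _ := by ring

theorem Complex.norm_exp_mul_I_sub_taylor_two_le (x : ℝ) :
    ‖Complex.exp (x * Complex.I) - (1 + x * Complex.I - (x : ℂ) ^ 2 / 2)‖ ≤ 4 * |x| ^ 3 := by
  have hnorm : ‖(x : ℂ) * Complex.I‖ = |x| := by simp
  rcases le_or_gt |x| 1 with hx | hx
  · have h := Complex.exp_bound (x := x * Complex.I) (by rw [hnorm]; exact hx) (n := 3) (by norm_num)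
    rw [hnorm] at h
    have hsum : ∑ m ∈ Finset.range 3, ((x : ℂ) * Complex.I) ^ m / (m.factorial : ℂ)
        = 1 + x * Complex.I - (x : ℂ) ^ 2 / 2 := by
      simp [Finset.sum_range_succ, mul_pow]
      ring
    rw [hsum] at h
    refine h.trans ?_
    have h3 : 0 ≤ |x| ^ 3 := by positivity
    norm_num [Nat.factorial]
    nlinarith
  · have h1 : ‖Complex.exp (x * Complex.I)‖ = 1 := Complex.norm_exp_ofReal_mul_I x
    have h2 : ‖(1 + x * Complex.I - (x : ℂ) ^ 2 / 2)‖ ≤ 1 + |x| + |x| ^ 2 / 2 := by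
      refine (norm_sub_le _ _).trans ?_
      refine add_le_add ((norm_add_le _ _).trans ?_) ?_
      · rw [hnorm]; simp
      · simp
    refine (norm_sub_le _ _).trans ?_
    rw [h1]
    nlinarith [pow_le_pow_right₀ hx.le (show 1 ≤ 3 by norm_num),
      pow_le_pow_right₀ hx.le (show 2 ≤ 3 by norm_num), one_le_pow₀ hx.le (n := 3)]

theorem Real.abs_exp_sub_one_sub_id_le_sq {u : ℝ} (hu : u ≤ 0) :
    |Real.exp u - (1 + u)| ≤ u ^ 2 := by
  rw [abs_of_nonneg (by linarith [Real.add_one_le_exp u])]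
  rcases le_or_gt (-1) u with h | h
  · have := Real.norm_exp_sub_one_sub_id_le (x := u)
      (by rw [Real.norm_eq_abs, abs_le]; constructor <;> linarith)
    rw [Real.norm_eq_abs, Real.norm_eq_abs, sq_abs] at this
    linarith [le_abs_self (Real.exp u - 1 - u)]
  · have := Real.exp_le_one_iff.2 hu
    nlinarith

theorem integrable_pow_gaussianReal (n : ℕ) :
    Integrable (fun x : ℝ => x ^ n) (gaussianReal 0 1) := by
  have h := (memLp_id_gaussianReal (μ := 0) (v := 1) (n : NNReal)).integrable_norm_pow'
  refine h.mono (by fun_prop) (ae_of_all _ fun x => ?_)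
  simp

theorem hasDerivAt_integral_pow_mul_exp_gaussianReal (n : ℕ) (t : ℝ) :
    HasDerivAt (fun t : ℝ => ∫ x, x ^ n * Real.exp (t * x) ∂gaussianReal 0 1)
      (∫ x, x ^ (n + 1) * Real.exp (t * x) ∂gaussianReal 0 1) t := by
  refine hasDerivAt_integral_pow_mul_exp_real (X := fun x => x) ?_ n
  rw [integrableExpSet_fun_id_gaussianReal, interior_univ]
  trivial

theorem integral_pow_mul_exp_gaussianReal_succ (n : ℕ) {p p' : ℝ → ℝ}
    (h : ∀ t : ℝ, ∫ x, x ^ n * Real.exp (t * x) ∂gaussianReal 0 1 = p t * Real.exp (t ^ 2 / 2))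
    (hp : ∀ t, HasDerivAt p (p' t) t) (t : ℝ) :
    ∫ x, x ^ (n + 1) * Real.exp (t * x) ∂gaussianReal 0 1
      = (p' t + t * p t) * Real.exp (t ^ 2 / 2) := by
  have h1 := hasDerivAt_integral_pow_mul_exp_gaussianReal n t
  rw [funext h] at h1
  have h2 : HasDerivAt (fun t : ℝ => Real.exp (t ^ 2 / 2)) (Real.exp (t ^ 2 / 2) * t) t := by
    have := ((hasDerivAt_pow 2 t).div_const 2).exp
    convert this using 1
    simp
  rw [h1.unique ((hp t).mul h2)]
  ring

theorem moments_gaussianReal :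
    ∫ x, x ∂gaussianReal 0 1 = 0 ∧ ∫ x, x ^ 2 ∂gaussianReal 0 1 = 1 ∧
      ∫ x, x ^ 3 ∂gaussianReal 0 1 = 0 ∧ ∫ x, x ^ 4 ∂gaussianReal 0 1 = 3 := by
  have h0 : ∀ t : ℝ, ∫ x, x ^ 0 * Real.exp (t * x) ∂gaussianReal 0 1
      = 1 * Real.exp (t ^ 2 / 2) := by
    intro t
    have := congrFun (mgf_fun_id_gaussianReal (μ := 0) (v := 1)) t
    simpa [mgf] using this
  have h1 := integral_pow_mul_exp_gaussianReal_succ 0 h0 (fun t => hasDerivAt_const t 1)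
  have h2 := integral_pow_mul_exp_gaussianReal_succ 1 (p := fun t => t) (p' := fun _ => 1)
    (fun t => by rw [h1]; ring) hasDerivAt_id'
  have h3 := integral_pow_mul_exp_gaussianReal_succ 2 (p := fun t => 1 + t ^ 2)
    (p' := fun t => 2 * t) (fun t => by rw [h2]; ring)
    (fun t => ((hasDerivAt_pow 2 t).const_add 1).congr_deriv (by norm_num))
  have h4 := integral_pow_mul_exp_gaussianReal_succ 3 (p := fun t => 3 * t + t ^ 3)
    (p' := fun t => 3 + 3 * t ^ 2) (fun t => by rw [h3]; ring)
    (fun t => (((hasDerivAt_id' t).const_mul 3).add (hasDerivAt_pow 3 t)).congr_deriv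
      (by norm_num))
  refine ⟨?_, ?_, ?_, ?_⟩
  · simp
  · simpa using h2 0
  · simpa using h3 0
  · simpa using h4 0

theorem integral_quartic_gaussianReal (c₀ c₁ c₂ c₃ c₄ : ℝ) :
    ∫ x, (c₀ + c₁ * x + c₂ * x ^ 2 + c₃ * x ^ 3 + c₄ * x ^ 4) ∂gaussianReal 0 1
      = c₀ + c₂ + 3 * c₄ := by
  obtain ⟨h1, h2, h3, h4⟩ := moments_gaussianReal
  have h1' : ∫ x, x ^ 1 ∂gaussianReal 0 1 = 0 := by simp only [pow_one, h1]
  have i1 := (integrable_pow_gaussianReal 1).const_mul c₁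
  have i2 := (integrable_pow_gaussianReal 2).const_mul c₂
  have i3 := (integrable_pow_gaussianReal 3).const_mul c₃
  have i4 := (integrable_pow_gaussianReal 4).const_mul c₄
  have i01 : Integrable (fun x : ℝ => c₀ + c₁ * x ^ 1) (gaussianReal 0 1) :=
    (integrable_const c₀).add i1
  have i02 : Integrable (fun x : ℝ => c₀ + c₁ * x ^ 1 + c₂ * x ^ 2) (gaussianReal 0 1) := i01.add i2
  have i03 : Integrable (fun x : ℝ => c₀ + c₁ * x ^ 1 + c₂ * x ^ 2 + c₃ * x ^ 3)
    (gaussianReal 0 1) := i02.add i3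
  suffices h : ∫ x, (c₀ + c₁ * x ^ 1 + c₂ * x ^ 2 + c₃ * x ^ 3 + c₄ * x ^ 4) ∂gaussianReal 0 1
      = c₀ + c₂ + 3 * c₄ by
    simpa only [pow_one] using h
  rw [integral_add i03 i4, integral_add i02 i3, integral_add i01 i2,
    integral_add (integrable_const c₀) i1]
  simp only [integral_const_mul, h1', h2, h3, h4, integral_const, probReal_univ, smul_eq_mul]
  ring

/-- The centred quadratic form in two variables with linear coefficients `T 1, T 2` and quadratic
coefficients `T 3, T 4, T 5`. -/
noncomputable def quadForm (T : ℕ → ℝ) (p : ℝ × ℝ) : ℝ :=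
  T 1 * p.1 + T 2 * p.2 + T 3 * (p.1 ^ 2 - 1) + T 4 * (p.2 ^ 2 - 1) + T 5 * (p.1 * p.2)

/-- The variance of `quadForm T` under the standard Gaussian measure on `ℝ × ℝ`. -/
def quadVar (T : ℕ → ℝ) : ℝ :=
  T 1 ^ 2 + T 2 ^ 2 + 2 * T 3 ^ 2 + 2 * T 4 ^ 2 + T 5 ^ 2

/-- The `ℓ¹` norm of the coefficients of `quadForm T`. -/
def quadNorm (T : ℕ → ℝ) : ℝ := |T 1| + |T 2| + |T 3| + |T 4| + |T 5|

/-- The standard Gaussian measure on `ℝ × ℝ`. -/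
noncomputable def gaussianPair : Measure (ℝ × ℝ) := (gaussianReal 0 1).prod (gaussianReal 0 1)

instance (d : ℕ) : IsProbabilityMeasure (_root_.stdGaussian d) := by
  unfold _root_.stdGaussian; infer_instance

instance (d : ℕ) : IsProbabilityMeasure (prodGaussian d) := by
  unfold prodGaussian; infer_instance

instance : IsProbabilityMeasure gaussianPair := by
  unfold gaussianPair; infer_instance

theorem continuous_quadForm (T : ℕ → ℝ) : Continuous (quadForm T) := by
  unfold quadForm; fun_prop

theorem quadNorm_nonneg (T : ℕ → ℝ) : 0 ≤ quadNorm T := by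
  unfold quadNorm; positivity

theorem quadVar_nonneg (T : ℕ → ℝ) : 0 ≤ quadVar T := by
  unfold quadVar; positivity

theorem quadVar_le (T : ℕ → ℝ) : quadVar T ≤ 2 * quadNorm T ^ 2 := by
  unfold quadVar quadNorm
  rw [← sq_abs (T 1), ← sq_abs (T 2), ← sq_abs (T 3), ← sq_abs (T 4), ← sq_abs (T 5)]
  have h1 := abs_nonneg (T 1)
  have h2 := abs_nonneg (T 2)
  have h3 := abs_nonneg (T 3)
  have h4 := abs_nonneg (T 4)
  have h5 := abs_nonneg (T 5)
  generalize |T 1| = a at *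
  generalize |T 2| = b at *
  generalize |T 3| = c at *
  generalize |T 4| = d at *
  generalize |T 5| = e at *
  have : 2 * (a + b + c + d + e) ^ 2 - (a ^ 2 + b ^ 2 + 2 * c ^ 2 + 2 * d ^ 2 + e ^ 2)
    = a ^ 2 + b ^ 2 + e ^ 2 + 4 * (a * b + a * c + a * d + a * e + b * c + b * d + b * e + c * d
      + c * e + d * e) := by ring
  have : 0 ≤ a ^ 2 + b ^ 2 + e ^ 2 + 4 * (a * b + a * c + a * d + a * e + b * c + b * d + b * e
    + c * d + c * e + d * e) := by positivity
  linarith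

theorem quadNorm_sq_le (T : ℕ → ℝ) : quadNorm T ^ 2 ≤ 5 * quadVar T := by
  unfold quadVar quadNorm
  rw [← sq_abs (T 1), ← sq_abs (T 2), ← sq_abs (T 3), ← sq_abs (T 4), ← sq_abs (T 5)]
  generalize |T 1| = a
  generalize |T 2| = b
  generalize |T 3| = c
  generalize |T 4| = d
  generalize |T 5| = e
  nlinarith [sq_nonneg (a - b), sq_nonneg (a - c), sq_nonneg (a - d), sq_nonneg (a - e),
    sq_nonneg (b - c), sq_nonneg (b - d), sq_nonneg (b - e), sq_nonneg (c - d),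
    sq_nonneg (c - e), sq_nonneg (d - e)]

theorem abs_quadForm_le (T : ℕ → ℝ) (p : ℝ × ℝ) :
    |quadForm T p| ≤ quadNorm T * (1 + p.1 ^ 2 + p.2 ^ 2) := by
  obtain ⟨x, y⟩ := p
  have hx : |x| ≤ 1 + x ^ 2 + y ^ 2 := by
    rw [abs_le]; constructor <;> nlinarith [sq_nonneg (x - 1), sq_nonneg (x + 1), sq_nonneg y]
  have hy : |y| ≤ 1 + x ^ 2 + y ^ 2 := by
    rw [abs_le]; constructor <;> nlinarith [sq_nonneg (y - 1), sq_nonneg (y + 1), sq_nonneg x]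
  have hx2 : |x ^ 2 - 1| ≤ 1 + x ^ 2 + y ^ 2 := by
    rw [abs_le]; constructor <;> nlinarith [sq_nonneg x, sq_nonneg y]
  have hy2 : |y ^ 2 - 1| ≤ 1 + x ^ 2 + y ^ 2 := by
    rw [abs_le]; constructor <;> nlinarith [sq_nonneg x, sq_nonneg y]
  have hxy : |x * y| ≤ 1 + x ^ 2 + y ^ 2 := by
    rw [abs_le]; constructor <;> nlinarith [sq_nonneg (x - y), sq_nonneg (x + y)]
  unfold quadForm quadNorm
  calc |T 1 * x + T 2 * y + T 3 * (x ^ 2 - 1) + T 4 * (y ^ 2 - 1) + T 5 * (x * y)|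
      ≤ |T 1 * x| + |T 2 * y| + |T 3 * (x ^ 2 - 1)| + |T 4 * (y ^ 2 - 1)| + |T 5 * (x * y)| := by
        refine (abs_add_le _ _).trans (add_le_add_left ?_ _)
        refine (abs_add_le _ _).trans (add_le_add_left ?_ _)
        refine (abs_add_le _ _).trans (add_le_add_left ?_ _)
        exact abs_add_le _ _
    _ ≤ |T 1| * (1 + x ^ 2 + y ^ 2) + |T 2| * (1 + x ^ 2 + y ^ 2) + |T 3| * (1 + x ^ 2 + y ^ 2)
        + |T 4| * (1 + x ^ 2 + y ^ 2) + |T 5| * (1 + x ^ 2 + y ^ 2) := by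
        simp only [abs_mul (T _)]
        gcongr
    _ = _ := by ring

theorem integrable_weight_gaussianPair :
    Integrable (fun p : ℝ × ℝ => (1 + p.1 ^ 2 + p.2 ^ 2) ^ 3) gaussianPair := by
  have h : ∀ (m n : ℕ), Integrable (fun p : ℝ × ℝ => p.1 ^ m * p.2 ^ n) gaussianPair := fun m n =>
    (integrable_pow_gaussianReal m).mul_prod (integrable_pow_gaussianReal n)
  have : (fun p : ℝ × ℝ => (1 + p.1 ^ 2 + p.2 ^ 2) ^ 3) = fun p =>
      p.1 ^ 0 * p.2 ^ 0 + p.1 ^ 6 * p.2 ^ 0 + p.1 ^ 0 * p.2 ^ 6 + 3 * (p.1 ^ 2 * p.2 ^ 0)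
      + 3 * (p.1 ^ 0 * p.2 ^ 2) + 3 * (p.1 ^ 4 * p.2 ^ 0) + 3 * (p.1 ^ 4 * p.2 ^ 2)
      + 3 * (p.1 ^ 0 * p.2 ^ 4) + 3 * (p.1 ^ 2 * p.2 ^ 4) + 6 * (p.1 ^ 2 * p.2 ^ 2) := by
    ext p; ring
  rw [this]
  exact (((((((((h 0 0).add (h 6 0)).add (h 0 6)).add ((h 2 0).const_mul 3)).add
    ((h 0 2).const_mul 3)).add ((h 4 0).const_mul 3)).add ((h 4 2).const_mul 3)).add
    ((h 0 4).const_mul 3)).add ((h 2 4).const_mul 3)).add ((h 2 2).const_mul 6)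

theorem integrable_abs_quadForm_pow (T : ℕ → ℝ) {n : ℕ} (hn : n ≤ 3) :
    Integrable (fun p => |quadForm T p| ^ n) gaussianPair := by
  have hc := continuous_quadForm T
  refine (integrable_weight_gaussianPair.const_mul (quadNorm T ^ n)).mono'
    (by fun_prop) (ae_of_all _ fun p => ?_)
  have hw : 1 ≤ 1 + p.1 ^ 2 + p.2 ^ 2 := by nlinarith [sq_nonneg p.1, sq_nonneg p.2]
  rw [Real.norm_eq_abs, abs_of_nonneg (by positivity)]
  calc |quadForm T p| ^ n ≤ (quadNorm T * (1 + p.1 ^ 2 + p.2 ^ 2)) ^ n := by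
        gcongr; exact abs_quadForm_le T p
    _ = quadNorm T ^ n * (1 + p.1 ^ 2 + p.2 ^ 2) ^ n := mul_pow _ _ _
    _ ≤ _ := by
        have := quadNorm_nonneg T
        gcongr

theorem integrable_quadForm (T : ℕ → ℝ) : Integrable (quadForm T) gaussianPair := by
  refine (integrable_abs_quadForm_pow T (n := 1) (by norm_num)).mono'
    (continuous_quadForm T).aestronglyMeasurable (ae_of_all _ fun p => ?_)
  simp

theorem integrable_quadForm_sq (T : ℕ → ℝ) :
    Integrable (fun p => quadForm T p ^ 2) gaussianPair := by
  simpa using integrable_abs_quadForm_pow T (n := 2) (by norm_num)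

theorem integral_quadForm (T : ℕ → ℝ) : ∫ p, quadForm T p ∂gaussianPair = 0 := by
  rw [gaussianPair, integral_prod _ (integrable_quadForm T)]
  have inner : ∀ x : ℝ, ∫ y, quadForm T (x, y) ∂gaussianReal 0 1
      = -T 3 + T 1 * x + T 3 * x ^ 2 + 0 * x ^ 3 + 0 * x ^ 4 := fun x => by
    have h := integral_quartic_gaussianReal (T 1 * x + T 3 * (x ^ 2 - 1) - T 4)
      (T 2 + T 5 * x) (T 4) 0 0
    calc _ = _ := by
          refine Eq.trans (integral_congr_ae (ae_of_all _ fun y => ?_)) h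
          simp only [quadForm]; ring
      _ = _ := by ring
  simp only [inner]
  rw [integral_quartic_gaussianReal]
  ring

theorem integral_quadForm_sq (T : ℕ → ℝ) :
    ∫ p, quadForm T p ^ 2 ∂gaussianPair = quadVar T := by
  rw [gaussianPair, integral_prod _ (integrable_quadForm_sq T)]
  have inner : ∀ x : ℝ, ∫ y, quadForm T (x, y) ^ 2 ∂gaussianReal 0 1
      = (T 3 ^ 2 + T 2 ^ 2 + 2 * T 4 ^ 2) + (2 * T 2 * T 5 - 2 * T 1 * T 3) * x
        + (T 1 ^ 2 - 2 * T 3 ^ 2 + T 5 ^ 2) * x ^ 2 + (2 * T 1 * T 3) * x ^ 3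
        + T 3 ^ 2 * x ^ 4 := fun x => by
    have h := integral_quartic_gaussianReal ((T 1 * x + T 3 * (x ^ 2 - 1) - T 4) ^ 2)
      (2 * (T 1 * x + T 3 * (x ^ 2 - 1) - T 4) * (T 2 + T 5 * x))
      ((T 2 + T 5 * x) ^ 2 + 2 * (T 1 * x + T 3 * (x ^ 2 - 1) - T 4) * T 4)
      (2 * (T 2 + T 5 * x) * T 4) (T 4 ^ 2)
    calc _ = _ := by
          refine Eq.trans (integral_congr_ae (ae_of_all _ fun y => ?_)) h
          simp only [quadForm]; ring
      _ = _ := by ring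
  simp only [inner]
  rw [integral_quartic_gaussianReal, quadVar]
  ring

/-- An absolute constant controlling the third absolute moments of `quadForm T`. -/
noncomputable def quadConst : ℝ := 4 * ∫ p : ℝ × ℝ, (1 + p.1 ^ 2 + p.2 ^ 2) ^ 3 ∂gaussianPair

theorem norm_charFun_quadForm_sub_le (T : ℕ → ℝ) (t : ℝ) :
    ‖∫ p, Complex.exp ((t * quadForm T p : ℝ) * Complex.I) ∂gaussianPair
        - ((1 - t ^ 2 * quadVar T / 2 : ℝ) : ℂ)‖ ≤ quadConst * |t| ^ 3 * quadNorm T ^ 3 := by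
  have hc := continuous_quadForm T
  have hint : Integrable (fun p => Complex.exp ((t * quadForm T p : ℝ) * Complex.I))
      gaussianPair := by
    refine (integrable_const (1 : ℝ)).mono' (by fun_prop) (ae_of_all _ fun p => ?_)
    rw [Complex.norm_exp_ofReal_mul_I]
  have i1 : Integrable (fun p => ((t * quadForm T p : ℝ) : ℂ) * Complex.I) gaussianPair :=
    (((integrable_quadForm T).const_mul t).ofReal).mul_const _
  have i2 : Integrable (fun p => ((t * quadForm T p : ℝ) : ℂ) ^ 2 / 2) gaussianPair := by
    have := (((integrable_quadForm_sq T).const_mul (t ^ 2 / 2)).ofReal (𝕜 := ℂ))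
    refine this.congr (ae_of_all _ fun p => ?_)
    simp; ring
  have i01 : Integrable (fun p => 1 + ((t * quadForm T p : ℝ) : ℂ) * Complex.I) gaussianPair :=
    (integrable_const 1).add i1
  have i02 : Integrable (fun p => 1 + ((t * quadForm T p : ℝ) : ℂ) * Complex.I
      - ((t * quadForm T p : ℝ) : ℂ) ^ 2 / 2) gaussianPair := i01.sub i2
  have hval : ∫ p, (1 + ((t * quadForm T p : ℝ) : ℂ) * Complex.I
      - ((t * quadForm T p : ℝ) : ℂ) ^ 2 / 2) ∂gaussianPair
      = ((1 - t ^ 2 * quadVar T / 2 : ℝ) : ℂ) := by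
    rw [integral_sub i01 i2, integral_add (integrable_const 1) i1, integral_mul_const,
      integral_complex_ofReal, integral_const_mul, integral_quadForm]
    have : ∀ p, ((t * quadForm T p : ℝ) : ℂ) ^ 2 / 2
        = ((t ^ 2 / 2 * quadForm T p ^ 2 : ℝ) : ℂ) := fun p => by
      push_cast; ring
    simp only [this]
    rw [integral_complex_ofReal, integral_const_mul, integral_quadForm_sq]
    simp
    ring
  rw [← hval, ← integral_sub hint i02]
  have hbound : ∀ p, ‖Complex.exp ((t * quadForm T p : ℝ) * Complex.I)
      - (1 + ((t * quadForm T p : ℝ) : ℂ) * Complex.I - ((t * quadForm T p : ℝ) : ℂ) ^ 2 / 2)‖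
      ≤ 4 * |t| ^ 3 * quadNorm T ^ 3 * (1 + p.1 ^ 2 + p.2 ^ 2) ^ 3 := fun p => by
    refine (Complex.norm_exp_mul_I_sub_taylor_two_le _).trans ?_
    calc 4 * |t * quadForm T p| ^ 3 = 4 * |t| ^ 3 * |quadForm T p| ^ 3 := by
          rw [abs_mul]; ring
      _ ≤ 4 * |t| ^ 3 * (quadNorm T * (1 + p.1 ^ 2 + p.2 ^ 2)) ^ 3 := by
          gcongr; exact abs_quadForm_le T p
      _ = _ := by ring
  refine (norm_integral_le_of_norm_le (integrable_weight_gaussianPair.const_mul _)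
    (ae_of_all _ hbound)).trans (le_of_eq ?_)
  rw [integral_const_mul, quadConst]
  ring

theorem norm_charFun_quadForm_sub_exp_le (T : ℕ → ℝ) (t : ℝ) :
    ‖∫ p, Complex.exp ((t * quadForm T p : ℝ) * Complex.I) ∂gaussianPair
        - ((Real.exp (-(t ^ 2 * quadVar T / 2)) : ℝ) : ℂ)‖
      ≤ quadConst * |t| ^ 3 * quadNorm T ^ 3 + t ^ 4 * quadNorm T ^ 4 := by
  have hv := quadVar_nonneg T
  have h1 := norm_charFun_quadForm_sub_le T t
  have h2 : ‖((1 - t ^ 2 * quadVar T / 2 : ℝ) : ℂ)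
      - ((Real.exp (-(t ^ 2 * quadVar T / 2)) : ℝ) : ℂ)‖ ≤ t ^ 4 * quadNorm T ^ 4 := by
    rw [← Complex.ofReal_sub, Complex.norm_real, Real.norm_eq_abs, abs_sub_comm]
    have hneg : -(t ^ 2 * quadVar T / 2) ≤ 0 := by
      rw [neg_nonpos]; positivity
    have := Real.abs_exp_sub_one_sub_id_le_sq hneg
    rw [← sub_eq_add_neg] at this
    refine this.trans ?_
    calc (-(t ^ 2 * quadVar T / 2)) ^ 2 = t ^ 4 * (quadVar T) ^ 2 / 4 := by ring
      _ ≤ t ^ 4 * (2 * quadNorm T ^ 2) ^ 2 / 4 := by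
          gcongr
          exact quadVar_le T
      _ = _ := by ring
  calc _ ≤ _ := norm_sub_le_norm_sub_add_norm_sub _ ((1 - t ^ 2 * quadVar T / 2 : ℝ) : ℂ) _
    _ ≤ _ := add_le_add h1 h2

theorem measurePreserving_pi_gaussianPair (d : ℕ) :
    MeasurePreserving (MeasurableEquiv.arrowProdEquivProdArrow ℝ ℝ (Fin d))
      (Measure.pi fun _ : Fin d => gaussianPair) (prodGaussian d) :=
  measurePreserving_arrowProdEquivProdArrow ℝ ℝ (Fin d) (fun _ => gaussianReal 0 1)
    (fun _ => gaussianReal 0 1)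

theorem integral_exp_sum_quadForm {d : ℕ} (T : Fin d → ℕ → ℝ) (c t : ℝ) :
    ∫ ω, Complex.exp ((t * (c + ∑ i, quadForm (T i) (ω.1 i, ω.2 i)) : ℝ) * Complex.I)
        ∂prodGaussian d
      = Complex.exp ((t * c : ℝ) * Complex.I) *
        ∏ i, ∫ p, Complex.exp ((t * quadForm (T i) p : ℝ) * Complex.I) ∂gaussianPair := by
  rw [← (measurePreserving_pi_gaussianPair d).integral_comp', ← integral_fintype_prod_eq_prod,
    ← integral_const_mul]
  refine integral_congr_ae (ae_of_all _ fun ω => ?_)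
  simp only [MeasurableEquiv.arrowProdEquivProdArrow, MeasurableEquiv.coe_mk,
    Equiv.arrowProdEquivProdArrow, Equiv.coe_fn_mk]
  rw [← Complex.exp_sum, ← Complex.exp_add]
  congr 1
  push_cast
  rw [mul_add, Finset.mul_sum, add_mul, Finset.sum_mul]

theorem norm_integral_exp_sum_quadForm_sub_le {d : ℕ} (T : Fin d → ℕ → ℝ) (c t m : ℝ)
    (hm : ∀ i, quadNorm (T i) ≤ m) :
    ‖∫ ω, Complex.exp ((t * (c + ∑ i, quadForm (T i) (ω.1 i, ω.2 i)) : ℝ) * Complex.I)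
        ∂prodGaussian d
      - Complex.exp ((t * c : ℝ) * Complex.I) *
        ((Real.exp (-(t ^ 2 * (∑ i, quadVar (T i)) / 2)) : ℝ) : ℂ)‖
      ≤ (quadConst * |t| ^ 3 * m + t ^ 4 * m ^ 2) * ∑ i, quadNorm (T i) ^ 2 := by
  have hC : 0 ≤ quadConst := by
    unfold quadConst
    have : 0 ≤ ∫ p : ℝ × ℝ, (1 + p.1 ^ 2 + p.2 ^ 2) ^ 3 ∂gaussianPair :=
      integral_nonneg fun p => by positivity
    positivity
  have hexp : ((Real.exp (-(t ^ 2 * (∑ i, quadVar (T i)) / 2)) : ℝ) : ℂ)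
      = ∏ i, ((Real.exp (-(t ^ 2 * quadVar (T i) / 2)) : ℝ) : ℂ) := by
    rw [← Complex.ofReal_prod, ← Real.exp_sum, Finset.sum_neg_distrib, Finset.mul_sum,
      Finset.sum_div]
  rw [integral_exp_sum_quadForm, hexp, ← mul_sub, norm_mul, Complex.norm_exp_ofReal_mul_I, one_mul]
  refine (Finset.norm_prod_sub_prod_le_sum _ _ _ (fun i => ?_) (fun i => ?_)).trans ?_
  · refine (norm_integral_le_of_norm_le (integrable_const (1 : ℝ)) (ae_of_all _ fun p => ?_)).trans
      (by simp)
    rw [Complex.norm_exp_ofReal_mul_I]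
  · rw [Complex.norm_real, Real.norm_eq_abs, Real.abs_exp, Real.exp_le_one_iff, neg_nonpos]
    have := quadVar_nonneg (T i)
    positivity
  · rw [Finset.mul_sum]
    refine Finset.sum_le_sum fun i _ => (norm_charFun_quadForm_sub_exp_le (T i) t).trans ?_
    have h0 := quadNorm_nonneg (T i)
    calc _ = quadConst * |t| ^ 3 * quadNorm (T i) * quadNorm (T i) ^ 2
          + t ^ 4 * quadNorm (T i) ^ 2 * quadNorm (T i) ^ 2 := by ring
      _ ≤ quadConst * |t| ^ 3 * m * quadNorm (T i) ^ 2 + t ^ 4 * m ^ 2 * quadNorm (T i) ^ 2 := by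
          gcongr <;> exact hm i
      _ = _ := by ring

theorem tendsto_integral_of_tendsto_charFun {P : ℕ → Measure ℝ} [∀ d, IsProbabilityMeasure (P d)]
    {P₀ : Measure ℝ} [IsProbabilityMeasure P₀]
    (h : ∀ t, Tendsto (fun d => charFun (P d) t) atTop (𝓝 (charFun P₀ t)))
    (f : BoundedContinuousFunction ℝ ℝ) :
    Tendsto (fun d => ∫ z, f z ∂P d) atTop (𝓝 (∫ z, f z ∂P₀)) := by
  have h' : Tendsto (β := ProbabilityMeasure ℝ) (fun d => ⟨P d, inferInstance⟩) atTop
      (𝓝 (⟨P₀, inferInstance⟩ : ProbabilityMeasure ℝ)) := ProbabilityMeasure.tendsto_iff_tendsto_charFun.2 h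
  exact ProbabilityMeasure.tendsto_iff_forall_integral_tendsto.1 h' f

theorem charFun_gaussianReal_eq_mul (μ t : ℝ) (v : NNReal) :
    charFun (gaussianReal μ v) t = Complex.exp ((t * μ : ℝ) * Complex.I) *
      ((Real.exp (-(t ^ 2 * v / 2)) : ℝ) : ℂ) := by
  rw [charFun_gaussianReal, Complex.ofReal_exp, ← Complex.exp_add]
  congr 1
  push_cast
  ring

theorem measurable_sum_quadForm {d : ℕ} (T : Fin d → ℕ → ℝ) (c : ℝ) : Measurable
    (fun ω : (Fin d → ℝ) × (Fin d → ℝ) => c + ∑ i, quadForm (T i) (ω.1 i, ω.2 i)) :=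
  measurable_const.add (Finset.measurable_fun_sum _ fun i _ =>
    (continuous_quadForm (T i)).measurable.comp (by fun_prop))

theorem tendsto_integral_exp_sum_quadForm (T : ∀ d : ℕ, Fin d → ℕ → ℝ) (c m : ℕ → ℝ) (μ : ℝ)
    (v : ℝ) (hm : ∀ d i, quadNorm (T d i) ≤ m d) (hm0 : Tendsto m atTop (𝓝 0))
    (hc : Tendsto c atTop (𝓝 μ)) (hv : Tendsto (fun d => ∑ i, quadVar (T d i)) atTop (𝓝 v))
    (t : ℝ) :
    Tendsto (fun d => ∫ ω,
      Complex.exp ((t * (c d + ∑ i, quadForm (T d i) (ω.1 i, ω.2 i)) : ℝ) * Complex.I)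
        ∂prodGaussian d) atTop
      (𝓝 (Complex.exp ((t * μ : ℝ) * Complex.I) * ((Real.exp (-(t ^ 2 * v / 2)) : ℝ) : ℂ))) := by
  have hlim : Tendsto (fun d => Complex.exp ((t * c d : ℝ) * Complex.I) *
      ((Real.exp (-(t ^ 2 * (∑ i, quadVar (T d i)) / 2)) : ℝ) : ℂ)) atTop
      (𝓝 (Complex.exp ((t * μ : ℝ) * Complex.I) * ((Real.exp (-(t ^ 2 * v / 2)) : ℝ) : ℂ))) := by
    have h1 : Continuous fun x : ℝ => Complex.exp ((t * x : ℝ) * Complex.I) := by fun_prop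
    have h2 : Continuous fun x : ℝ => ((Real.exp (-(t ^ 2 * x / 2)) : ℝ) : ℂ) := by fun_prop
    exact ((h1.tendsto μ).comp hc).mul ((h2.tendsto v).comp hv)
  have hsq : ∀ d, ∑ i, quadNorm (T d i) ^ 2 ≤ 5 * ∑ i, quadVar (T d i) := fun d => by
    rw [Finset.mul_sum]
    exact Finset.sum_le_sum fun i _ => quadNorm_sq_le _
  have herr : Tendsto (fun d => (quadConst * |t| ^ 3 * m d + t ^ 4 * m d ^ 2) *
      ∑ i, quadNorm (T d i) ^ 2) atTop (𝓝 0) := by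
    have h1 : Tendsto (fun d => quadConst * |t| ^ 3 * m d + t ^ 4 * m d ^ 2) atTop (𝓝 0) := by
      simpa using (hm0.const_mul (quadConst * |t| ^ 3)).add ((hm0.pow 2).const_mul (t ^ 4))
    have h2 := h1.abs.mul (hv.const_mul 5)
    rw [abs_zero, zero_mul] at h2
    refine squeeze_zero_norm (fun d => ?_) h2
    rw [norm_mul, Real.norm_eq_abs, Real.norm_eq_abs]
    refine mul_le_mul_of_nonneg_left ?_ (abs_nonneg _)
    rw [abs_of_nonneg (Finset.sum_nonneg fun i _ => sq_nonneg _)]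
    exact hsq d
  have hdiff := squeeze_zero_norm (fun d =>
    norm_integral_exp_sum_quadForm_sub_le (T d) (c d) t (m d) (hm d)) herr
  simpa only [sub_add_cancel, zero_add] using hdiff.add hlim

/-- Central limit theorem for sums of independent quadratic forms in Gaussian variables. -/
theorem tendsto_integral_sum_quadForm (T : ∀ d : ℕ, Fin d → ℕ → ℝ) (c m : ℕ → ℝ) (μ : ℝ)
    (v : NNReal) (hm : ∀ d i, quadNorm (T d i) ≤ m d) (hm0 : Tendsto m atTop (𝓝 0))
    (hc : Tendsto c atTop (𝓝 μ))
    (hv : Tendsto (fun d => ∑ i, quadVar (T d i)) atTop (𝓝 (v : ℝ)))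
    (f : BoundedContinuousFunction ℝ ℝ) :
    Tendsto (fun d => ∫ ω, f (c d + ∑ i, quadForm (T d i) (ω.1 i, ω.2 i)) ∂prodGaussian d) atTop
      (𝓝 (∫ z, f z ∂gaussianReal μ v)) := by
  have hprob : ∀ d, IsProbabilityMeasure ((prodGaussian d).map
      fun ω => c d + ∑ i, quadForm (T d i) (ω.1 i, ω.2 i)) :=
    fun d => Measure.isProbabilityMeasure_map (measurable_sum_quadForm (T d) (c d)).aemeasurable
  have h := tendsto_integral_of_tendsto_charFun (P := fun d => (prodGaussian d).map
      fun ω => c d + ∑ i, quadForm (T d i) (ω.1 i, ω.2 i)) (P₀ := gaussianReal μ v)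
      (fun t => ?_) f
  · refine h.congr fun d => ?_
    rw [integral_map (measurable_sum_quadForm (T d) (c d)).aemeasurable
      f.continuous.aestronglyMeasurable]
  rw [charFun_gaussianReal_eq_mul]
  refine (tendsto_integral_exp_sum_quadForm T c m μ v hm hm0 hc hv t).congr fun d => ?_
  rw [charFun_apply_real,
    integral_map (measurable_sum_quadForm (T d) (c d)).aemeasurable (by fun_prop)]
  simp only [Complex.ofReal_mul]

/-- A triangular array satisfying Lyapunov's condition, with bounded sums of squares, is uniformly
small. -/
theorem exists_tendsto_zero_of_lyapunov (x : ∀ d : ℕ, Fin d → ℝ) (V : ℕ → ℝ) {δ v : ℝ}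
    (hδ : 0 < δ) (hV : Tendsto V atTop (𝓝 v)) (hx : ∀ d, ∑ i, x d i ^ 2 ≤ V d)
    (h : Tendsto (fun d : ℕ => (∑ i, |x d i| ^ (2 + δ)) / (∑ i, x d i ^ 2) ^ (1 + δ / 2))
      atTop (𝓝 0)) :
    ∃ m : ℕ → ℝ, Tendsto m atTop (𝓝 0) ∧ ∀ d i, |x d i| ≤ m d := by
  refine ⟨fun d => (∑ i, |x d i| ^ (2 + δ)) ^ (2 + δ)⁻¹, ?_, fun d i => ?_⟩
  · have hL : Tendsto (fun d => ∑ i, |x d i| ^ (2 + δ)) atTop (𝓝 0) := by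
      have hb := h.mul (hV.rpow_const (p := 1 + δ / 2) (Or.inr (by positivity)))
      rw [zero_mul] at hb
      refine squeeze_zero (fun d => by positivity) (fun d => ?_) hb
      have hS : 0 ≤ ∑ i, x d i ^ 2 := by positivity
      rcases hS.eq_or_lt with hS0 | hS0
      · have hz : ∀ i, x d i = 0 := fun i => by
          have := (Finset.sum_eq_zero_iff_of_nonneg (fun i _ => sq_nonneg (x d i))).1 hS0.symm i
            (Finset.mem_univ i)
          exact pow_eq_zero_iff (by norm_num) |>.1 this
        have : (2 + δ) ≠ 0 := by positivity
        simp [hz, Real.zero_rpow this]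
      · calc ∑ i, |x d i| ^ (2 + δ)
            = (∑ i, |x d i| ^ (2 + δ)) / (∑ i, x d i ^ 2) ^ (1 + δ / 2)
              * (∑ i, x d i ^ 2) ^ (1 + δ / 2) := by
              have := Real.rpow_pos_of_pos hS0 (1 + δ / 2)
              field_simp
          _ ≤ _ := by
              gcongr
              exact hx d
    have := hL.rpow_const (p := (2 + δ)⁻¹) (Or.inr (by positivity))
    rwa [Real.zero_rpow (by positivity)] at this
  · have h2 : (0 : ℝ) < 2 + δ := by positivity
    rw [Real.le_rpow_inv_iff_of_pos (abs_nonneg _) (by positivity) h2]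
    exact Finset.single_le_sum (f := fun i => |x d i| ^ (2 + δ)) (fun i _ => by positivity)
      (Finset.mem_univ i)

/-- The standard Gaussian measure is invariant under orthogonal matrices. -/
theorem measurePreserving_mulVec_stdGaussian {d : ℕ} {O : Matrix (Fin d) (Fin d) ℝ}
    (hO : O * Oᵀ = 1) :
    MeasurePreserving (O *ᵥ ·) (_root_.stdGaussian d) (_root_.stdGaussian d) := by
  have hm : Measurable (O *ᵥ · : (Fin d → ℝ) → Fin d → ℝ) := by fun_prop
  have hp' : IsProbabilityMeasure ((_root_.stdGaussian d).map (O *ᵥ ·)) :=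
    Measure.isProbabilityMeasure_map hm.aemeasurable
  have hchar : ∀ t : EuclideanSpace ℝ (Fin d),
      ∫ x, Complex.exp ((x ⬝ᵥ t.ofLp : ℝ) * Complex.I) ∂_root_.stdGaussian d
        = Complex.exp (-((t.ofLp ⬝ᵥ t.ofLp : ℝ) : ℂ) / 2) := fun t => by
    have h := charFun_stdGaussian t
    rw [← map_pi_eq_stdGaussian, charFun_apply,
      integral_map (by fun_prop) (by fun_prop)] at h
    have h2 : (‖t‖ : ℂ) ^ 2 = ((t.ofLp ⬝ᵥ t.ofLp : ℝ) : ℂ) := by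
      rw [← Complex.ofReal_pow, EuclideanSpace.real_norm_sq_eq, dotProduct]
      simp [sq]
    rw [h2] at h
    rw [_root_.stdGaussian, ← h]
    refine integral_congr_ae (ae_of_all _ fun x => ?_)
    simp [PiLp.inner_apply, dotProduct, mul_comm]
  refine ⟨hm, ?_⟩
  have key : ((_root_.stdGaussian d).map (O *ᵥ ·)).map (WithLp.toLp 2)
      = (_root_.stdGaussian d).map (WithLp.toLp 2) := by
    have : IsProbabilityMeasure (((_root_.stdGaussian d).map (O *ᵥ ·)).map (WithLp.toLp 2)) :=
      Measure.isProbabilityMeasure_map (by fun_prop)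
    have : IsProbabilityMeasure ((_root_.stdGaussian d).map (WithLp.toLp 2)) :=
      Measure.isProbabilityMeasure_map (by fun_prop)
    refine Measure.ext_of_charFun (funext fun t => ?_)
    rw [charFun_apply, charFun_apply, integral_map (by fun_prop) (by fun_prop),
      integral_map hm.aemeasurable (by fun_prop), integral_map (by fun_prop) (by fun_prop)]
    have e1 := hchar t
    have e2 := hchar (WithLp.toLp 2 (Oᵀ *ᵥ t.ofLp))
    have e3 : (Oᵀ *ᵥ t.ofLp) ⬝ᵥ (Oᵀ *ᵥ t.ofLp) = t.ofLp ⬝ᵥ t.ofLp := by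
      rw [dotProduct_mulVec, vecMul_transpose, mulVec_mulVec, hO, one_mulVec]
    have e4 : ∀ x, x ⬝ᵥ (Oᵀ *ᵥ t.ofLp) = (O *ᵥ x) ⬝ᵥ t.ofLp := fun x => by
      rw [dotProduct_mulVec, vecMul_transpose]
    simp only [e3, e4] at e2
    have e := e2.trans e1.symm
    convert e using 4 <;> simp [PiLp.inner_apply, dotProduct, mul_comm]
  exact (MeasurableEquiv.toLp 2 (Fin d → ℝ)).map_measurableEquiv_injective key

theorem measurePreserving_mulVec_prodGaussian {d : ℕ} {O₁ O₂ : Matrix (Fin d) (Fin d) ℝ}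
    (h₁ : O₁ * O₁ᵀ = 1) (h₂ : O₂ * O₂ᵀ = 1) :
    MeasurePreserving (Prod.map (O₁ *ᵥ ·) (O₂ *ᵥ ·)) (prodGaussian d) (prodGaussian d) :=
  (measurePreserving_mulVec_stdGaussian h₁).prod (measurePreserving_mulVec_stdGaussian h₂)

theorem gaussianReal_real_Iio {μ σ : ℝ} {v : NNReal} (hσ : 0 < σ) (hv : (v : ℝ) = σ ^ 2)
    (x : ℝ) :
    (gaussianReal μ v).real (Set.Iio x) = Phi ((x - μ) / σ) := by
  have h : (gaussianReal 0 1).map (fun z => μ + σ * z) = gaussianReal μ v := by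
    have : (fun z => μ + σ * z) = (fun z => μ + z) ∘ (fun z => σ * z) := rfl
    rw [this, ← Measure.map_map (by fun_prop) (by fun_prop), gaussianReal_map_const_mul,
      gaussianReal_map_const_add]
    congr 1
    · simp
    · exact NNReal.coe_injective (by simp [hv])
  have : NullSingletonClass (gaussianReal 0 1) := nullSingletonClass_gaussianReal one_ne_zero
  rw [← h, map_measureReal_apply (by fun_prop) measurableSet_Iio, Phi]
  have hs : (fun z => μ + σ * z) ⁻¹' Set.Iio x = Set.Iio ((x - μ) / σ) := by
    ext z
    simp only [Set.mem_preimage, Set.mem_Iio]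
    rw [lt_div_iff₀ hσ]
    constructor <;> intro h <;> linarith
  rw [hs, measureReal_def, measure_congr Iio_ae_eq_Iic]

theorem gaussianReal_real_Ici {μ σ : ℝ} {v : NNReal} (hσ : 0 < σ) (hv : (v : ℝ) = σ ^ 2)
    (x : ℝ) :
    (gaussianReal μ v).real (Set.Ici x) = Phi ((μ - x) / σ) := by
  have h : (gaussianReal 0 1).map (fun z => μ + (-σ) * z)
      = gaussianReal μ v := by
    have : (fun z => μ + (-σ) * z) = (fun z => μ + z) ∘ (fun z => (-σ) * z) := rfl
    rw [this, ← Measure.map_map (by fun_prop) (by fun_prop), gaussianReal_map_const_mul,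
      gaussianReal_map_const_add]
    congr 1
    · simp
    · exact NNReal.coe_injective (by simp [hv])
  rw [← h, map_measureReal_apply (by fun_prop) measurableSet_Ici, Phi]
  have hs : (fun z => μ + (-σ) * z) ⁻¹' Set.Ici x = Set.Iic ((μ - x) / σ) := by
    ext z
    simp only [Set.mem_preimage, Set.mem_Ici, Set.mem_Iic]
    rw [le_div_iff₀ hσ]
    constructor <;> intro h <;> linarith
  rw [hs, measureReal_def]

theorem exp_mul_gaussianPDFReal (μ : ℝ) {v : NNReal} (hv : v ≠ 0) (z : ℝ) :
    gaussianPDFReal μ v z * Real.exp z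
      = Real.exp (μ + v / 2) * gaussianPDFReal (μ + v) v z := by
  have hv' : (v : ℝ) ≠ 0 := by exact_mod_cast hv
  rw [gaussianPDFReal, gaussianPDFReal, mul_assoc, ← Real.exp_add, mul_left_comm, ← Real.exp_add]
  congr 2
  field_simp
  ring

theorem integral_min_one_exp_gaussianReal (μ : ℝ) {σ : ℝ} {v : NNReal} (hσ : 0 < σ)
    (hv : (v : ℝ) = σ ^ 2) :
    ∫ z, min 1 (Real.exp z) ∂gaussianReal μ v
      = Phi (μ / σ) + Real.exp (μ + σ ^ 2 / 2) * Phi (-σ - μ / σ) := by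
  have hv0 : v ≠ 0 := by
    rw [Ne, ← NNReal.coe_inj, hv]; exact (pow_pos hσ 2).ne'
  have hint : Integrable (fun z => min 1 (Real.exp z)) (gaussianReal μ v) := by
    refine Integrable.of_bound (by fun_prop) 1 (ae_of_all _ fun z => ?_)
    rw [Real.norm_eq_abs, abs_of_nonneg (by positivity)]
    exact min_le_left _ _
  have h1 : ∫ z in Set.Ici 0, min 1 (Real.exp z) ∂gaussianReal μ v
      = Phi (μ / σ) := by
    rw [setIntegral_congr_fun (g := fun _ => (1 : ℝ)) measurableSet_Ici fun z hz =>
      min_eq_left (Real.one_le_exp hz)]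
    simp [gaussianReal_real_Ici hσ hv]
  have h2 : ∫ z in Set.Iio 0, min 1 (Real.exp z) ∂gaussianReal μ v
      = Real.exp (μ + σ ^ 2 / 2) * Phi (-σ - μ / σ) := by
    rw [setIntegral_congr_fun (g := Real.exp) measurableSet_Iio fun z (hz : z < 0) =>
      min_eq_right (Real.exp_le_one_iff.2 hz.le)]
    have h3 : -σ - μ / σ = (0 - (μ + σ ^ 2)) / σ := by field_simp; ring
    rw [h3, ← gaussianReal_real_Iio hσ hv, measureReal_def, gaussianReal_apply_eq_integral _ hv0,
      ENNReal.toReal_ofReal (integral_nonneg fun z => gaussianPDFReal_nonneg _ _ _),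
      ← integral_const_mul, ← integral_indicator measurableSet_Iio,
      integral_gaussianReal_eq_integral_smul hv0, ← integral_indicator measurableSet_Iio]
    refine integral_congr_ae (ae_of_all _ fun z => ?_)
    by_cases hz : z ∈ Set.Iio (0 : ℝ)
    · simp only [Set.indicator_of_mem hz, smul_eq_mul]
      rw [← hv]
      exact exp_mul_gaussianPDFReal μ hv0 z
    · simp [Set.indicator_of_notMem hz]
  rw [← h1, ← h2, ← Set.compl_Ici, integral_add_compl measurableSet_Ici hint]

section SimultaneousDiagonalization

variable {d : ℕ} {Q : Matrix (Fin d) (Fin d) ℝ}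

theorem eq_mul_diagonal_mul_transpose (hQ : Qᵀ * Q = 1) {B : Matrix (Fin d) (Fin d) ℝ}
    {c : Fin d → ℝ} (hB : Qᵀ * B * Q = diagonal c) : B = Q * diagonal c * Qᵀ := by
  have hQ' : Q * Qᵀ = 1 := mul_eq_one_comm.1 hQ
  rw [← hB]
  simp only [Matrix.mul_assoc, hQ', Matrix.mul_one]
  rw [← Matrix.mul_assoc, hQ', Matrix.one_mul]

theorem transpose_mul_conj_diagonal_mul (hQ : Qᵀ * Q = 1) (c : Fin d → ℝ) :
    Qᵀ * (Q * diagonal c * Qᵀ) * Q = diagonal c := by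
  simp only [Matrix.mul_assoc, hQ, Matrix.mul_one]
  rw [← Matrix.mul_assoc, hQ, Matrix.one_mul]

theorem conj_diagonal_mul_conj_diagonal (hQ : Qᵀ * Q = 1) (c c' : Fin d → ℝ) :
    (Q * diagonal c * Qᵀ) * (Q * diagonal c' * Qᵀ) = Q * diagonal (fun i => c i * c' i) * Qᵀ := by
  rw [← diagonal_mul_diagonal]
  simp only [Matrix.mul_assoc]
  rw [← Matrix.mul_assoc Qᵀ Q, hQ, Matrix.one_mul]

theorem transpose_conj_diagonal (c : Fin d → ℝ) :
    (Q * diagonal c * Qᵀ)ᵀ = Q * diagonal c * Qᵀ := by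
  simp [Matrix.mul_assoc]

theorem conj_diagonal_sub_conj_diagonal (c c' : Fin d → ℝ) :
    Q * diagonal c * Qᵀ - Q * diagonal c' * Qᵀ = Q * diagonal (fun i => c i - c' i) * Qᵀ := by
  rw [← diagonal_sub, Matrix.mul_sub, Matrix.sub_mul]

theorem inv_conj_diagonal (hQ : Qᵀ * Q = 1) {c : Fin d → ℝ} (hc : ∀ i, c i ≠ 0) :
    (Q * diagonal c * Qᵀ)⁻¹ = Q * diagonal (fun i => (c i)⁻¹) * Qᵀ := by
  refine inv_eq_right_inv ?_
  rw [conj_diagonal_mul_conj_diagonal hQ]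
  simp only [mul_inv_cancel₀ (hc _), diagonal_one, Matrix.mul_one]
  exact mul_eq_one_comm.1 hQ

theorem det_conj_diagonal (hQ : Qᵀ * Q = 1) (c : Fin d → ℝ) :
    (Q * diagonal c * Qᵀ).det = ∏ i, c i := by
  have h : Qᵀ.det * Q.det = 1 := by rw [← det_mul, hQ, det_one]
  rw [det_mul, det_mul, det_diagonal, mul_right_comm, mul_comm Q.det, h, one_mul]

theorem transpose_mulVec_conj_diagonal_mulVec (hQ : Qᵀ * Q = 1) (c v : Fin d → ℝ) (i : Fin d) :
    (Qᵀ *ᵥ ((Q * diagonal c * Qᵀ) *ᵥ v)) i = c i * (Qᵀ *ᵥ v) i := by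
  rw [mulVec_mulVec, Matrix.mul_assoc Q, ← Matrix.mul_assoc Qᵀ, hQ, Matrix.one_mul,
    ← mulVec_mulVec, mulVec_diagonal]

theorem dotProduct_eq_sum_transpose_mulVec (hQ : Qᵀ * Q = 1) (u v : Fin d → ℝ) :
    u ⬝ᵥ v = ∑ i, (Qᵀ *ᵥ u) i * (Qᵀ *ᵥ v) i := by
  change _ = (Qᵀ *ᵥ u) ⬝ᵥ (Qᵀ *ᵥ v)
  rw [dotProduct_mulVec, vecMul_transpose, mulVec_mulVec, mul_eq_one_comm.1 hQ, one_mulVec]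

theorem abs_lt_one_of_spectrum_conj_diagonal (hQ : Qᵀ * Q = 1) {c : Fin d → ℝ}
    (h : ∀ z ∈ spectrum ℂ ((Q * diagonal c * Qᵀ).map (algebraMap ℝ ℂ)), ‖z‖ < 1) (i : Fin d) :
    |c i| < 1 := by
  rw [← Real.norm_eq_abs, ← Complex.norm_real]
  refine h _ fun hu => ?_
  have h1 : algebraMap ℂ (Matrix (Fin d) (Fin d) ℂ) (c i : ℂ)
        - (Q * diagonal c * Qᵀ).map (algebraMap ℝ ℂ)
      = (algebraMap ℝ ℂ).mapMatrix (Q * diagonal (fun j => c i - c j) * Qᵀ) := by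
    have h2 : Q * diagonal (fun _ => c i) * Qᵀ = diagonal fun _ => c i := by
      have : (diagonal fun _ : Fin d => c i) = c i • (1 : Matrix (Fin d) (Fin d) ℝ) :=
        (smul_one_eq_diagonal _).symm
      rw [this, Matrix.mul_smul, Matrix.mul_one, Matrix.smul_mul, mul_eq_one_comm.1 hQ]
    rw [← conj_diagonal_sub_conj_diagonal, map_sub, h2]
    congr 1
    ext j k
    by_cases hjk : j = k <;> simp [algebraMap_matrix_apply, hjk]
  rw [spectrum.mem_resolventSet_iff, h1, isUnit_iff_isUnit_det, ← RingHom.map_det, det_conj_diagonal hQ,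
    Finset.prod_eq_zero (Finset.mem_univ i) (sub_self _)] at hu
  simp at hu

theorem diagonal_mul_transpose_mul_mul_transpose_eq_one (hQ : Qᵀ * Q = 1)
    {S : Matrix (Fin d) (Fin d) ℝ} {c a : Fin d → ℝ} (hS : S * Sᵀ = Q * diagonal c * Qᵀ)
    (ha : ∀ i, a i ^ 2 * c i = 1) :
    (diagonal a * Qᵀ * S) * (diagonal a * Qᵀ * S)ᵀ = 1 := by
  have : (diagonal a * Qᵀ * S) * (diagonal a * Qᵀ * S)ᵀ
      = diagonal a * (Qᵀ * (S * Sᵀ) * Q) * diagonal a := by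
    simp [Matrix.mul_assoc]
  rw [this, hS, transpose_mul_conj_diagonal_mul hQ, diagonal_mul_diagonal, diagonal_mul_diagonal,
    ← diagonal_one]
  congr 1
  funext i
  rw [← ha i]
  ring

end SimultaneousDiagonalization

/-- The contribution of one eigendirection to the log acceptance ratio. -/
theorem log_ratio_coordinate_eq {l lt g m mt s ξ η : ℝ} (hl : 0 < l) (hlt : 0 < lt)
    (hs : 0 < s) (hsg : s ^ 2 = 1 - g ^ 2) :
    -(1 / 2) * ((l ^ 2 - lt ^ 2) * (g * (m + ξ / l) + (1 - g) * mt + s / lt * η) ^ 2)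
      + 1 / 2 * ((l ^ 2 - lt ^ 2) * (m + ξ / l) ^ 2)
      + (l ^ 2 * m - lt ^ 2 * mt) * ((g * (m + ξ / l) + (1 - g) * mt + s / lt * η) - (m + ξ / l))
    = muT l lt g (m - mt) + quadForm (fun j => Tfun j l lt g (m - mt)) (ξ, η) := by
  have hr : Real.sqrt (l ^ 2 / lt ^ 2 * (1 - g ^ 2)) = l / lt * s := by
    rw [← hsg, ← div_pow, ← mul_pow, Real.sqrt_sq (by positivity)]
  simp only [muT, quadForm, Tfun, hr]
  rw [← sub_eq_zero]
  trans -(1 / 2) * ((l ^ 2 - lt ^ 2) / lt ^ 2 * η ^ 2) * (s ^ 2 - (1 - g ^ 2))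
  · field_simp
    ring
  · rw [hsg, sub_self, mul_zero]

/-- Up to independent rotations of the two Gaussian inputs, the log acceptance ratio is a sum of
independent quadratic forms. -/
theorem exists_orthogonal_Zlog_eq_sum {d : ℕ} {A M N Q R Cν : Matrix (Fin d) (Fin d) ℝ}
    {b β lam lamt Gi mv mtv : Fin d → ℝ} (hM : IsUnit M)
    (hG : ∀ z ∈ spectrum ℂ ((M⁻¹ * N).map (algebraMap ℝ ℂ)), ‖z‖ < 1)
    (hQ : Qᵀ * Q = 1) (hdA : (Qᵀ * A * Q).IsDiag) (hdM : (Qᵀ * M * Q).IsDiag)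
    (hdN : (Qᵀ * N * Q).IsDiag) (hlam : ∀ i, 0 < lam i ∧ lam i ^ 2 = (Qᵀ * A * Q) i i)
    (hlamt : ∀ i, 0 < lamt i ∧ lamt i ^ 2 = (Qᵀ * (M - N) * Q) i i)
    (hGi : ∀ i, Gi i = (Qᵀ * (M⁻¹ * N) * Q) i i)
    (hmv : ∀ i, mv i = (Qᵀ *ᵥ (A⁻¹ *ᵥ b)) i)
    (hmtv : ∀ i, mtv i = (Qᵀ *ᵥ ((M - N)⁻¹ *ᵥ β)) i)
    (hR : R * Rᵀ = A⁻¹)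
    (hCν : Cν * Cνᵀ = (M - N)⁻¹ - (M⁻¹ * N) * (M - N)⁻¹ * (M⁻¹ * N)ᵀ) :
    ∃ O₁ O₂ : Matrix (Fin d) (Fin d) ℝ, O₁ * O₁ᵀ = 1 ∧ O₂ * O₂ᵀ = 1 ∧
      ∀ ω, Zlog A M N b β R Cν ω = ∑ i, muT (lam i) (lamt i) (Gi i) (mv i - mtv i) +
        ∑ i, quadForm (fun j => Tfun j (lam i) (lamt i) (Gi i) (mv i - mtv i))
          ((O₁ *ᵥ ω.1) i, (O₂ *ᵥ ω.2) i) := by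
  obtain ⟨p, hp⟩ : ∃ p, p = (Qᵀ * M * Q).diag := ⟨_, rfl⟩
  obtain ⟨n, hn⟩ : ∃ n, n = (Qᵀ * N * Q).diag := ⟨_, rfl⟩
  have hAe : A = Q * diagonal (fun i => lam i ^ 2) * Qᵀ := by
    refine eq_mul_diagonal_mul_transpose hQ ?_
    rw [← hdA.diagonal_diag]
    exact congrArg diagonal (funext fun i => (hlam i).2.symm)
  have hMe : M = Q * diagonal p * Qᵀ :=
    eq_mul_diagonal_mul_transpose hQ (by rw [hp, hdM.diagonal_diag])
  have hNe : N = Q * diagonal n * Qᵀ :=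
    eq_mul_diagonal_mul_transpose hQ (by rw [hn, hdN.diagonal_diag])
  have hlamt2 : ∀ i, p i - n i = lamt i ^ 2 := fun i => by
    rw [(hlamt i).2, hMe, hNe, conj_diagonal_sub_conj_diagonal, transpose_mul_conj_diagonal_mul hQ,
      diagonal_apply_eq]
  have hMNe : M - N = Q * diagonal (fun i => lamt i ^ 2) * Qᵀ := by
    rw [hMe, hNe, conj_diagonal_sub_conj_diagonal]
    simp only [hlamt2]
  have hp0 : ∀ i, p i ≠ 0 := fun i h0 => by
    rw [isUnit_iff_isUnit_det, hMe, det_conj_diagonal hQ,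
      Finset.prod_eq_zero (Finset.mem_univ i) h0] at hM
    exact not_isUnit_zero hM
  have hMinv : M⁻¹ = Q * diagonal (fun i => (p i)⁻¹) * Qᵀ := by
    rw [hMe, inv_conj_diagonal hQ hp0]
  have hlam0 : ∀ i, lam i ^ 2 ≠ 0 := fun i => pow_ne_zero 2 (hlam i).1.ne'
  have hlamt0 : ∀ i, lamt i ^ 2 ≠ 0 := fun i => pow_ne_zero 2 (hlamt i).1.ne'
  have hAinv : A⁻¹ = Q * diagonal (fun i => (lam i ^ 2)⁻¹) * Qᵀ := by
    rw [hAe, inv_conj_diagonal hQ hlam0]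
  have hMNinv : (M - N)⁻¹ = Q * diagonal (fun i => (lamt i ^ 2)⁻¹) * Qᵀ := by
    rw [hMNe, inv_conj_diagonal hQ hlamt0]
  have hGe' : M⁻¹ * N = Q * diagonal (fun i => (p i)⁻¹ * n i) * Qᵀ := by
    rw [hMinv, hNe, conj_diagonal_mul_conj_diagonal hQ]
  have hGi' : ∀ i, Gi i = (p i)⁻¹ * n i := fun i => by
    rw [hGi, hGe', transpose_mul_conj_diagonal_mul hQ, diagonal_apply_eq]
  have hGe : M⁻¹ * N = Q * diagonal Gi * Qᵀ := by rw [hGe', funext hGi']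
  have hp1 : ∀ i, (p i)⁻¹ * lamt i ^ 2 = 1 - Gi i := fun i => by
    rw [← hlamt2, hGi', mul_sub, inv_mul_cancel₀ (hp0 i)]
  rw [hGe] at hG
  have hg : ∀ i, 0 < 1 - Gi i ^ 2 := fun i => by
    have := (sq_lt_one_iff_abs_lt_one _).2 (abs_lt_one_of_spectrum_conj_diagonal hQ hG i)
    linarith
  obtain ⟨s, hs⟩ : ∃ s : Fin d → ℝ, ∀ i, 0 < s i ∧ s i ^ 2 = 1 - Gi i ^ 2 :=
    ⟨fun i => Real.sqrt (1 - Gi i ^ 2), fun i => ⟨Real.sqrt_pos.2 (hg i), Real.sq_sqrt (hg i).le⟩⟩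
  rw [hAinv] at hR
  rw [hMNinv, hGe, transpose_conj_diagonal, conj_diagonal_mul_conj_diagonal hQ,
    conj_diagonal_mul_conj_diagonal hQ, conj_diagonal_sub_conj_diagonal] at hCν
  have hbhat : ∀ i, (Qᵀ *ᵥ b) i = lam i ^ 2 * mv i := fun i => by
    rw [hmv, hAinv, transpose_mulVec_conj_diagonal_mulVec hQ, mul_inv_cancel_left₀ (hlam0 i)]
  have hβhat : ∀ i, (Qᵀ *ᵥ β) i = lamt i ^ 2 * mtv i := fun i => by
    rw [hmtv, hMNinv, transpose_mulVec_conj_diagonal_mulVec hQ, mul_inv_cancel_left₀ (hlamt0 i)]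
  refine ⟨diagonal lam * Qᵀ * R, diagonal (fun i => lamt i / s i) * Qᵀ * Cν,
    diagonal_mul_transpose_mul_mul_transpose_eq_one hQ hR fun i => mul_inv_cancel₀ (hlam0 i),
    diagonal_mul_transpose_mul_mul_transpose_eq_one hQ hCν fun i => ?_, fun ω => ?_⟩
  · have h1 := (hs i).2
    have h2 := (hs i).1.ne'
    have h3 := (hlamt i).1.ne'
    field_simp
    linarith
  have hO₁ : ∀ i, (Qᵀ *ᵥ (R *ᵥ ω.1)) i = ((diagonal lam * Qᵀ * R) *ᵥ ω.1) i / lam i := fun i => by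
    rw [← mulVec_mulVec, ← mulVec_mulVec, mulVec_diagonal, mul_div_cancel_left₀ _ (hlam i).1.ne']
  have hO₂ : ∀ i, (Qᵀ *ᵥ (Cν *ᵥ ω.2)) i
      = s i / lamt i * ((diagonal (fun i => lamt i / s i) * Qᵀ * Cν) *ᵥ ω.2) i := fun i => by
    have h2 := (hs i).1.ne'
    have h3 := (hlamt i).1.ne'
    rw [← mulVec_mulVec, ← mulVec_mulVec, mulVec_diagonal]
    field_simp
  obtain ⟨ξ, hξ⟩ : ∃ ξ, ξ = (diagonal lam * Qᵀ * R) *ᵥ ω.1 := ⟨_, rfl⟩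
  obtain ⟨η, hη⟩ : ∃ η, η = (diagonal (fun i => lamt i / s i) * Qᵀ * Cν) *ᵥ ω.2 := ⟨_, rfl⟩
  rw [← hξ] at hO₁ ⊢
  rw [← hη] at hO₂ ⊢
  obtain ⟨x, hx⟩ : ∃ x, x = xeq A b R ω.1 := ⟨_, rfl⟩
  obtain ⟨y, hy⟩ : ∃ y, y = yprop A M N b β R Cν ω := ⟨_, rfl⟩
  have hxhat : ∀ i, (Qᵀ *ᵥ x) i = mv i + ξ i / lam i := fun i => by
    rw [hx, xeq, mulVec_add, Pi.add_apply, ← hmv, hO₁]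
  have hyhat : ∀ i, (Qᵀ *ᵥ y) i = Gi i * (mv i + ξ i / lam i) + (1 - Gi i) * mtv i
      + s i / lamt i * η i := fun i => by
    rw [hy, yprop, ← hx, mulVec_add, mulVec_add, Pi.add_apply, Pi.add_apply, hO₂, hGe, hMinv,
      transpose_mulVec_conj_diagonal_mulVec hQ, transpose_mulVec_conj_diagonal_mulVec hQ, hxhat,
      hβhat, ← mul_assoc, hp1]
  rw [Zlog, ← hx, ← hy, hMNe, hAe, conj_diagonal_sub_conj_diagonal,
    dotProduct_eq_sum_transpose_mulVec hQ, dotProduct_eq_sum_transpose_mulVec hQ,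
    dotProduct_eq_sum_transpose_mulVec hQ, Finset.mul_sum, Finset.mul_sum,
    ← Finset.sum_add_distrib, ← Finset.sum_add_distrib, ← Finset.sum_add_distrib]
  refine Finset.sum_congr rfl fun i _ => ?_
  rw [← log_ratio_coordinate_eq (hlam i).1 (hlamt i).1 (hs i).1 (hs i).2,
    transpose_mulVec_conj_diagonal_mulVec hQ, transpose_mulVec_conj_diagonal_mulVec hQ,
    mulVec_sub, mulVec_sub, Pi.sub_apply, Pi.sub_apply, hxhat, hyhat, hbhat, hβhat]
  ring

theorem sq_le_quadVar (T : ℕ → ℝ) {j : ℕ} (hj : j ∈ Finset.Icc 1 5) : T j ^ 2 ≤ quadVar T := by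
  unfold quadVar
  obtain ⟨h1, h5⟩ := Finset.mem_Icc.1 hj
  interval_cases j <;>
    nlinarith [sq_nonneg (T 1), sq_nonneg (T 2), sq_nonneg (T 3), sq_nonneg (T 4), sq_nonneg (T 5)]


/-- Theorem: expected acceptance rate, Gaussian target. If the splitting
matrices `M`, `N` are functions of `A` (simultaneously diagonalized by an orthogonal `Q`),
the chain is in equilibrium `x ~ N(A⁻¹b, A⁻¹)`, the Lyapunov-type condition on the `T_{ji}`
holds for some `δ > 0`, and `μ = lim Σᵢ μ_{d,i}`, `σ² = lim Σᵢ σ_{d,i}²` exist, then the log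
acceptance ratio `Z` converges in distribution to `N(μ, σ²)` and
`E[1 ∧ e^Z] → Φ(μ/σ) + e^{μ+σ²/2} Φ(-σ-μ/σ)` as `d → ∞`. -/
theorem gaussian_target_expected_acceptance
    (A M N : ∀ d : ℕ, Matrix (Fin d) (Fin d) ℝ)
    (b β : ∀ d : ℕ, Fin d → ℝ)
    (Q R Cν : ∀ d : ℕ, Matrix (Fin d) (Fin d) ℝ)
    (lam lamt Gi mv mtv : ∀ d : ℕ, Fin d → ℝ)
    (hA : ∀ d, (A d).PosDef)
    (hM : ∀ d, IsUnit (M d))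
    (hAcal : ∀ d, (M d - N d).PosDef)
    (hG : ∀ d, ∀ z ∈ spectrum ℂ (((M d)⁻¹ * N d).map (algebraMap ℝ ℂ)), ‖z‖ < 1)
    (hQ : ∀ d, (Q d)ᵀ * Q d = 1)
    (hdA : ∀ d, ((Q d)ᵀ * A d * Q d).IsDiag)
    (hdM : ∀ d, ((Q d)ᵀ * M d * Q d).IsDiag)
    (hdN : ∀ d, ((Q d)ᵀ * N d * Q d).IsDiag)
    (hlam : ∀ d i, 0 < lam d i ∧ lam d i ^ 2 = ((Q d)ᵀ * A d * Q d) i i)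
    (hlamt : ∀ d i, 0 < lamt d i ∧ lamt d i ^ 2 = ((Q d)ᵀ * (M d - N d) * Q d) i i)
    (hGi : ∀ d i, Gi d i = ((Q d)ᵀ * ((M d)⁻¹ * N d) * Q d) i i)
    (hmv : ∀ d i, mv d i = (Q d)ᵀ.mulVec ((A d)⁻¹.mulVec (b d)) i)
    (hmtv : ∀ d i, mtv d i = (Q d)ᵀ.mulVec ((M d - N d)⁻¹.mulVec (β d)) i)
    (hR : ∀ d, R d * (R d)ᵀ = (A d)⁻¹)
    (hCν : ∀ d, Cν d * (Cν d)ᵀ =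
      (M d - N d)⁻¹ - ((M d)⁻¹ * N d) * (M d - N d)⁻¹ * ((M d)⁻¹ * N d)ᵀ)
    (μ σ : ℝ) (hσ : 0 < σ)
    (hT : ∃ δ : ℝ, 0 < δ ∧ ∀ j ∈ Finset.Icc 1 5,
      Tendsto (fun d : ℕ =>
        (∑ i, |Tfun j (lam d i) (lamt d i) (Gi d i) (mv d i - mtv d i)| ^ (2 + δ)) /
          (∑ i, (Tfun j (lam d i) (lamt d i) (Gi d i) (mv d i - mtv d i)) ^ 2) ^ (1 + δ / 2))
        atTop (𝓝 0))
    (hμ : Tendsto (fun d : ℕ =>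
        ∑ i, muT (lam d i) (lamt d i) (Gi d i) (mv d i - mtv d i)) atTop (𝓝 μ))
    (hσ2 : Tendsto (fun d : ℕ =>
        ∑ i, sigT2 (lam d i) (lamt d i) (Gi d i) (mv d i - mtv d i)) atTop (𝓝 (σ ^ 2))) :
    (∀ f : BoundedContinuousFunction ℝ ℝ,
      Tendsto (fun d : ℕ =>
          ∫ ω, f (Zlog (A d) (M d) (N d) (b d) (β d) (R d) (Cν d) ω) ∂prodGaussian d)
        atTop (𝓝 (∫ z, f z ∂gaussianReal μ ⟨σ ^ 2, sq_nonneg σ⟩))) ∧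
    Tendsto (fun d : ℕ =>
        ∫ ω, min 1 (Real.exp (Zlog (A d) (M d) (N d) (b d) (β d) (R d) (Cν d) ω))
          ∂prodGaussian d)
      atTop (𝓝 (Phi (μ / σ) + Real.exp (μ + σ ^ 2 / 2) * Phi (-σ - μ / σ))) := by
  obtain ⟨δ, hδ, hT⟩ := hT
  obtain ⟨T, hTdef⟩ : ∃ T : ∀ d : ℕ, Fin d → ℕ → ℝ, T = fun d i j =>
    Tfun j (lam d i) (lamt d i) (Gi d i) (mv d i - mtv d i) := ⟨_, rfl⟩
  have hv : Tendsto (fun d => ∑ i, quadVar (T d i)) atTop (𝓝 (σ ^ 2)) := by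
    rw [hTdef]
    exact hσ2
  have hsmall : ∀ j ∈ Finset.Icc 1 5,
      ∃ m : ℕ → ℝ, Tendsto m atTop (𝓝 0) ∧ ∀ d i, |T d i j| ≤ m d := fun j hj => by
    refine exists_tendsto_zero_of_lyapunov (fun d i => T d i j) _ hδ hv
      (fun d => Finset.sum_le_sum fun i _ => ?_) (by rw [hTdef]; exact hT j hj)
    exact sq_le_quadVar (T d i) hj
  obtain ⟨m₁, h₁, hm₁⟩ := hsmall 1 (by decide)
  obtain ⟨m₂, h₂, hm₂⟩ := hsmall 2 (by decide)
  obtain ⟨m₃, h₃, hm₃⟩ := hsmall 3 (by decide)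
  obtain ⟨m₄, h₄, hm₄⟩ := hsmall 4 (by decide)
  obtain ⟨m₅, h₅, hm₅⟩ := hsmall 5 (by decide)
  have hm0 : Tendsto (fun d => m₁ d + m₂ d + m₃ d + m₄ d + m₅ d) atTop (𝓝 0) := by
    simpa using (((h₁.add h₂).add h₃).add h₄).add h₅
  have hm : ∀ d i, quadNorm (T d i) ≤ m₁ d + m₂ d + m₃ d + m₄ d + m₅ d := fun d i => by
    unfold quadNorm
    linarith [hm₁ d i, hm₂ d i, hm₃ d i, hm₄ d i, hm₅ d i]
  have hconv : ∀ f : BoundedContinuousFunction ℝ ℝ,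
      Tendsto (fun d : ℕ =>
          ∫ ω, f (Zlog (A d) (M d) (N d) (b d) (β d) (R d) (Cν d) ω) ∂prodGaussian d)
        atTop (𝓝 (∫ z, f z ∂gaussianReal μ ⟨σ ^ 2, sq_nonneg σ⟩)) := fun f => by
    refine (tendsto_integral_sum_quadForm T _ _ μ ⟨σ ^ 2, sq_nonneg σ⟩ hm hm0 hμ hv f).congr
      fun d => ?_
    obtain ⟨O₁, O₂, hO₁, hO₂, hZ⟩ := exists_orthogonal_Zlog_eq_sum (hM d) (hG d) (hQ d) (hdA d)
      (hdM d) (hdN d) (hlam d) (hlamt d) (hGi d) (hmv d) (hmtv d) (hR d) (hCν d)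
    have hO := measurePreserving_mulVec_prodGaussian hO₁ hO₂
    have hcomp := integral_map (μ := prodGaussian d) hO.measurable.aemeasurable
      (f := fun ω => f (∑ i, muT (lam d i) (lamt d i) (Gi d i) (mv d i - mtv d i)
        + ∑ i, quadForm (T d i) (ω.1 i, ω.2 i)))
      (f.continuous.measurable.comp (measurable_sum_quadForm (T d) _)).aestronglyMeasurable
    rw [hO.map_eq] at hcomp
    rw [hcomp]
    refine integral_congr_ae (ae_of_all _ fun ω => ?_)
    simp only [hZ ω, hTdef, Prod.map_fst, Prod.map_snd]
  refine ⟨hconv, ?_⟩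
  have hf : ∀ x : ℝ, ‖min 1 (Real.exp x)‖ ≤ 1 := fun x => by
    rw [Real.norm_eq_abs, abs_of_nonneg (by positivity)]
    exact min_le_left _ _
  have hlim := hconv (BoundedContinuousFunction.ofNormedAddCommGroup
    (fun x => min 1 (Real.exp x)) (by fun_prop) 1 hf)
  rw [← integral_min_one_exp_gaussianReal μ (v := ⟨σ ^ 2, sq_nonneg σ⟩) hσ rfl]
  exact hlim
end

section
/- Suppose there exists M̄ > 0 such that, for all sufficiently large d, |φ_d(x)| ≤ M̄ for all x ∈ ℝ^d. Then the Metropolis–Hastings algorithm with target π_d and AR(1) proposal, in equilibrium (x ~ π_d), satisfies: E_{π_d}[α(x,y)] ≤ e^{3M̄} E_{π̃_d}[α̃(x,y)], where E_{π̃_d}[α̃(x,y)] is the expected acceptance probability of the same proposal with Gaussian target π̃_d in equilibrium (x ~ π̃_d); and if E_{π̃_d}[|Z|] < ∞ then E_{π_d}[α(x,y)] > 0. -/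
open MeasureTheory ProbabilityTheory Matrix Filter
open scoped Topology

instance isProbabilityMeasure_prodGaussian (d : ℕ) : IsProbabilityMeasure (prodGaussian d) := by
  unfold prodGaussian _root_.stdGaussian
  infer_instance

lemma measurable_xeq_fst {d : ℕ} (A : Matrix (Fin d) (Fin d) ℝ) (b : Fin d → ℝ)
    (R : Matrix (Fin d) (Fin d) ℝ) :
    Measurable fun ω : (Fin d → ℝ) × (Fin d → ℝ) => xeq A b R ω.1 := by
  unfold xeq
  exact Continuous.measurable (by fun_prop)

lemma measurable_yprop {d : ℕ} (A M N : Matrix (Fin d) (Fin d) ℝ) (b β : Fin d → ℝ)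
    (R Cν : Matrix (Fin d) (Fin d) ℝ) : Measurable (yprop A M N b β R Cν) := by
  unfold yprop xeq
  exact Continuous.measurable (by fun_prop)

lemma measurable_Zlog {d : ℕ} (A M N : Matrix (Fin d) (Fin d) ℝ) (b β : Fin d → ℝ)
    (R Cν : Matrix (Fin d) (Fin d) ℝ) : Measurable (Zlog A M N b β R Cν) := by
  unfold Zlog yprop xeq
  exact Continuous.measurable (by fun_prop)

/-- Perturbing the log acceptance ratio by `u - v` and weighting by `e^{-u}`, with `u` and `v`
bounded by `K`, changes the acceptance probability by a factor of at most `e^{3K}`. -/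
lemma min_one_exp_mul_exp_neg_le {u v z K : ℝ} (hu : |u| ≤ K) (hv : |v| ≤ K) :
    min 1 (Real.exp (u - v + z)) * Real.exp (-u) ≤ Real.exp (3 * K) * min 1 (Real.exp z) := by
  obtain ⟨hu₁, hu₂⟩ := abs_le.mp hu
  obtain ⟨hv₁, hv₂⟩ := abs_le.mp hv
  have hK : 0 ≤ K := (abs_nonneg u).trans hu
  rw [min_mul_of_nonneg _ _ (Real.exp_pos _).le, mul_min_of_nonneg _ _ (Real.exp_pos _).le,
    one_mul, mul_one, ← Real.exp_add, ← Real.exp_add]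
  exact min_le_min (Real.exp_le_exp.mpr (by linarith)) (Real.exp_le_exp.mpr (by linarith))

section BoundedPerturbation

variable {Ω : Type*} [MeasurableSpace Ω] {μ : Measure Ω} {u v z : Ω → ℝ} {K : ℝ}

lemma integrable_min_one_exp [IsFiniteMeasure μ] (hz : Measurable z) :
    Integrable (fun ω => min 1 (Real.exp (z ω))) μ := by
  refine Integrable.of_bound (C := 1) (measurable_const.min hz.exp).aestronglyMeasurable
    (ae_of_all _ fun ω => ?_)
  rw [Real.norm_of_nonneg (by positivity)]
  exact min_le_left _ _

lemma integrable_min_one_exp_mul_exp_neg [IsFiniteMeasure μ] (hum : Measurable u)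
    (hvm : Measurable v) (hzm : Measurable z) (hu : ∀ ω, |u ω| ≤ K) (hv : ∀ ω, |v ω| ≤ K) :
    Integrable (fun ω => min 1 (Real.exp (u ω - v ω + z ω)) * Real.exp (-u ω)) μ := by
  refine ((integrable_min_one_exp hzm).const_mul (Real.exp (3 * K))).mono'
    (Measurable.aestronglyMeasurable ?_) (ae_of_all _ fun ω => ?_)
  · exact (measurable_const.min ((hum.sub hvm).add hzm).exp).mul hum.neg.exp
  · rw [Real.norm_of_nonneg (by positivity)]
    exact min_one_exp_mul_exp_neg_le (hu ω) (hv ω)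

lemma integral_min_one_exp_mul_exp_neg_le [IsFiniteMeasure μ] (hum : Measurable u)
    (hvm : Measurable v) (hzm : Measurable z) (hu : ∀ ω, |u ω| ≤ K) (hv : ∀ ω, |v ω| ≤ K) :
    ∫ ω, min 1 (Real.exp (u ω - v ω + z ω)) * Real.exp (-u ω) ∂μ ≤
      Real.exp (3 * K) * ∫ ω, min 1 (Real.exp (z ω)) ∂μ := by
  rw [← integral_const_mul]
  exact integral_mono (integrable_min_one_exp_mul_exp_neg hum hvm hzm hu hv)
    ((integrable_min_one_exp hzm).const_mul _)
    fun ω => min_one_exp_mul_exp_neg_le (hu ω) (hv ω)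

lemma integral_min_one_exp_mul_exp_neg_pos [IsFiniteMeasure μ] [NeZero μ] (hum : Measurable u)
    (hvm : Measurable v) (hzm : Measurable z) (hu : ∀ ω, |u ω| ≤ K) (hv : ∀ ω, |v ω| ≤ K) :
    0 < ∫ ω, min 1 (Real.exp (u ω - v ω + z ω)) * Real.exp (-u ω) ∂μ := by
  have hpos : ∀ ω, 0 < min 1 (Real.exp (u ω - v ω + z ω)) * Real.exp (-u ω) := fun ω => by
    positivity
  rw [integral_pos_iff_support_of_nonneg (fun ω => (hpos ω).le)
    (integrable_min_one_exp_mul_exp_neg hum hvm hzm hu hv),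
    Function.support_eq_univ (fun ω => (hpos ω).ne')]
  exact NeZero.pos _

end BoundedPerturbation

/-- Theorem: bounded change of measure. If `|φ_d| ≤ M̄` for all
sufficiently large `d`, then for the Metropolis–Hastings algorithm with non-Gaussian
target `π_d` (density `e^{-φ_d}` with respect to `π̃_d = N(A⁻¹b, A⁻¹)`), in equilibrium,
`E_{π_d}[α(x,y)] ≤ e^{3M̄} E_{π̃_d}[α̃(x,y)]`, and `E_{π_d}[α(x,y)] > 0` whenever
`E_{π̃_d}[|Z|] < ∞`. -/
theorem nongaussian_acceptance_bounds
    (A M N : ∀ d : ℕ, Matrix (Fin d) (Fin d) ℝ)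
    (b β : ∀ d : ℕ, Fin d → ℝ)
    (R Cν : ∀ d : ℕ, Matrix (Fin d) (Fin d) ℝ)
    (φ : ∀ d : ℕ, (Fin d → ℝ) → ℝ)
    (hA : ∀ d, (A d).PosDef)
    (hM : ∀ d, IsUnit (M d))
    (hAcal : ∀ d, (M d - N d).PosDef)
    (hG : ∀ d, ∀ z ∈ spectrum ℂ (((M d)⁻¹ * N d).map (algebraMap ℝ ℂ)), ‖z‖ < 1)
    (hR : ∀ d, R d * (R d)ᵀ = (A d)⁻¹)
    (hCν : ∀ d, Cν d * (Cν d)ᵀ =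
      (M d - N d)⁻¹ - ((M d)⁻¹ * N d) * (M d - N d)⁻¹ * ((M d)⁻¹ * N d)ᵀ)
    (hφmeas : ∀ d, Measurable (φ d))
    -- π_d is a probability measure: ∫ e^{-φ_d} dπ̃_d = 1
    (hnorm : ∀ d, ∫ ξ, Real.exp (-(φ d (xeq (A d) (b d) (R d) ξ))) ∂stdGaussian d = 1)
    (Mbar : ℝ) (hMbar : 0 < Mbar)
    (hφbdd : ∀ᶠ d in atTop, ∀ x : Fin d → ℝ, |φ d x| ≤ Mbar) :
    ∀ᶠ d in atTop,
      ((∫ ω, min 1 (Real.exp (φ d (xeq (A d) (b d) (R d) ω.1)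
            - φ d (yprop (A d) (M d) (N d) (b d) (β d) (R d) (Cν d) ω)
            + Zlog (A d) (M d) (N d) (b d) (β d) (R d) (Cν d) ω))
          * Real.exp (-(φ d (xeq (A d) (b d) (R d) ω.1))) ∂prodGaussian d)
        ≤ Real.exp (3 * Mbar) *
          ∫ ω, min 1 (Real.exp (Zlog (A d) (M d) (N d) (b d) (β d) (R d) (Cν d) ω))
            ∂prodGaussian d) ∧
      (Integrable (fun ω => Zlog (A d) (M d) (N d) (b d) (β d) (R d) (Cν d) ω)
          (prodGaussian d) →
        0 < ∫ ω, min 1 (Real.exp (φ d (xeq (A d) (b d) (R d) ω.1)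
            - φ d (yprop (A d) (M d) (N d) (b d) (β d) (R d) (Cν d) ω)
            + Zlog (A d) (M d) (N d) (b d) (β d) (R d) (Cν d) ω))
          * Real.exp (-(φ d (xeq (A d) (b d) (R d) ω.1))) ∂prodGaussian d) := by
  filter_upwards [hφbdd] with d hd
  have hu := (hφmeas d).comp (measurable_xeq_fst (A d) (b d) (R d))
  have hv := (hφmeas d).comp (measurable_yprop (A d) (M d) (N d) (b d) (β d) (R d) (Cν d))
  have hz := measurable_Zlog (A d) (M d) (N d) (b d) (β d) (R d) (Cν d)
  exact ⟨integral_min_one_exp_mul_exp_neg_le hu hv hz (fun _ => hd _) (fun _ => hd _),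
    fun _ => integral_min_one_exp_mul_exp_neg_pos hu hv hz (fun _ => hd _) (fun _ => hd _)⟩
end
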